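/- arXiv:1504.03502 — 7 statements merged into one kernel-verified Lean document; each statement's English description precedes it below -/
import Mathlib

section
/- Let m ≥ 2 be an integer, n = 2^m, and let C be a binary [n,k] code satisfying the conditions (C1) and (C2) with respect to a positive integer a. Then there exist 2^(k−m−1) Hadamard matrices H_1, …, H_{2^(k−m−1)} of order n such that for all i ≠ j the matrix (1/(2a)) · H_i H_j^T has entries in {0,1,−1} and is a weighing matrix of order n and weight (n/(2a))^2; that is, H_1, …, H_{2^(k−m−1)} are mutually quasi-unbiased weighing matrices for parameters (n, n, (n/(2a))^2, 4a^2). -/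
open Finset

/-- The (Hamming) weight of a vector over `ZMod 2`. -/
def wt {ι : Type*} [Fintype ι] (x : ι → ZMod 2) : ℕ :=
  (Finset.univ.filter fun i => x i ≠ 0).card

/-- The first order Reed–Muller code `RM(1,m)`: coordinates are indexed by the
points of `F_2^m`, and the codewords are the evaluation vectors
`v ↦ a·v + b` for `a ∈ F_2^m`, `b ∈ F_2`. -/
def RM1 (m : ℕ) : Set ((Fin m → ZMod 2) → ZMod 2) :=
  {f | ∃ (a : Fin m → ZMod 2) (b : ZMod 2), f = fun v => (∑ i, a i * v i) + b}

/-- A binary `[2^m, k]` code `C` satisfies conditions (C1) and (C2) with respect to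
a positive integer `a` with `0 < a < 2^m/2`:
(C1) the set of weights of codewords of `C` is exactly
`{0, 2^m/2 - a, 2^m/2, 2^m/2 + a, 2^m}`, and
(C2) `C` contains `RM(1,m)` as a subcode. -/
def SatCond (m k a : ℕ) (C : Submodule (ZMod 2) ((Fin m → ZMod 2) → ZMod 2)) : Prop :=
  Module.finrank (ZMod 2) C = k ∧ 0 < a ∧ a < 2 ^ m / 2 ∧
  {w : ℕ | ∃ x ∈ C, wt x = w} =
    ({0, 2 ^ m / 2 - a, 2 ^ m / 2, 2 ^ m / 2 + a, 2 ^ m} : Set ℕ) ∧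
  RM1 m ⊆ (C : Set ((Fin m → ZMod 2) → ZMod 2))

/-- `Ai C i` is the number `A_i(C)` of codewords of weight `i` in `C`. -/
noncomputable def Ai {ι : Type*} [Fintype ι] (C : Set (ι → ZMod 2)) (i : ℕ) : ℕ :=
  {x ∈ C | wt x = i}.ncard

/-- The minimum (nonzero) weight of a code. -/
noncomputable def dmin {ι : Type*} [Fintype ι] (C : Set (ι → ZMod 2)) : ℕ :=
  sInf {w : ℕ | ∃ x ∈ C, x ≠ 0 ∧ wt x = w}

/-- Two binary codes of the same length are equivalent if one is obtained from
the other by a permutation of the coordinates. -/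
def CodeEquiv {ι : Type*} [Fintype ι] (C C' : Set (ι → ZMod 2)) : Prop :=
  ∃ σ : Equiv.Perm ι, C' = (fun x => x ∘ σ) '' C

/-- The dual code of a binary code. -/
def dualCode {ι : Type*} [Fintype ι] (C : Submodule (ZMod 2) (ι → ZMod 2)) :
    Submodule (ZMod 2) (ι → ZMod 2) where
  carrier := {x | ∀ y ∈ C, ∑ i, x i * y i = 0}
  add_mem' := by
    intro x₁ x₂ h₁ h₂ y hy
    simp only [Set.mem_setOf_eq] at h₁ h₂ ⊢
    simp only [Pi.add_apply, add_mul, Finset.sum_add_distrib, h₁ y hy, h₂ y hy, add_zero]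
  zero_mem' := by
    intro y hy
    simp
  smul_mem' := by
    intro c x hx y hy
    simp only [Set.mem_setOf_eq] at hx ⊢
    simp only [Pi.smul_apply, smul_eq_mul, mul_assoc, ← Finset.mul_sum, hx y hy, mul_zero]

/-- The covering radius `ρ(C) = max_x min_{c ∈ C} wt (x - c)`. -/
noncomputable def covRad {ι : Type*} [Fintype ι] (C : Set (ι → ZMod 2)) : ℕ :=
  sSup {r : ℕ | ∃ x : ι → ZMod 2, r = sInf {w : ℕ | ∃ c ∈ C, w = wt (x - c)}}

/-- A code of length `2^m` satisfying the conditions (C1) and (C2) is maximal if it is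
not properly contained in any code of length `2^m` satisfying the conditions. -/
def MaximalSat (m : ℕ) (C : Submodule (ZMod 2) ((Fin m → ZMod 2) → ZMod 2)) : Prop :=
  (∃ k a, SatCond m k a C) ∧
  ∀ D : Submodule (ZMod 2) ((Fin m → ZMod 2) → ZMod 2),
    (∃ k a, SatCond m k a D) → C ≤ D → D = C

/-- `P` has exactly `N` equivalence classes of codes. -/
def ExactlyNClasses {m : ℕ} (N : ℕ)
    (P : Submodule (ZMod 2) ((Fin m → ZMod 2) → ZMod 2) → Prop) : Prop :=
  ∃ f : Fin N → Submodule (ZMod 2) ((Fin m → ZMod 2) → ZMod 2),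
    (∀ i, P (f i)) ∧
    (∀ i j, i ≠ j →
      ¬ CodeEquiv (↑(f i) : Set ((Fin m → ZMod 2) → ZMod 2)) (↑(f j))) ∧
    ∀ C, P C → ∃ i, CodeEquiv (↑C : Set ((Fin m → ZMod 2) → ZMod 2)) (↑(f i))

/-- A weighing matrix of order `n` and weight `k`. -/
def IsWeighing (n k : ℕ) (W : Matrix (Fin n) (Fin n) ℤ) : Prop :=
  (∀ i j, W i j = 0 ∨ W i j = 1 ∨ W i j = -1) ∧
  W * W.transpose = (k : ℤ) • (1 : Matrix (Fin n) (Fin n) ℤ)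

/-- A Hadamard matrix of order `n`. -/
def IsHadamard (n : ℕ) (H : Matrix (Fin n) (Fin n) ℤ) : Prop :=
  (∀ i j, H i j = 1 ∨ H i j = -1) ∧
  H * H.transpose = (n : ℤ) • (1 : Matrix (Fin n) (Fin n) ℤ)

/-- the sign character -/
def chi (x : ZMod 2) : ℤ := if x = 0 then 1 else -1

lemma chi_add (x y : ZMod 2) : chi (x + y) = chi x * chi y := by
  revert x y; decide

lemma chi_sq (x : ZMod 2) : chi x * chi x = 1 := by
  revert x; decide

lemma chi_pm (x : ZMod 2) : chi x = 1 ∨ chi x = -1 := by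
  revert x; decide

lemma chi_orth {m : ℕ} (d : Fin m → ZMod 2) :
    ∑ v : Fin m → ZMod 2, chi (∑ l, d l * v l) = if d = 0 then 2 ^ m else 0 := by
  split_ifs with h
  · subst h
    simp [chi, ZMod.card]
  · obtain ⟨l, hl⟩ := Function.ne_iff.mp h
    have hl1 : d l = 1 := by
      have : ∀ x : ZMod 2, x ≠ 0 → x = 1 := by decide
      exact this _ hl
    have key := Equiv.sum_comp (Equiv.addRight (Pi.single l (1 : ZMod 2)))
      (fun v : Fin m → ZMod 2 => chi (∑ l, d l * v l))
    have h2 : ∀ v : Fin m → ZMod 2,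
        chi (∑ i, d i * (Equiv.addRight (Pi.single l (1 : ZMod 2)) v) i)
          = - chi (∑ i, d i * v i) := by
      intro v
      have : ∑ i, d i * (Equiv.addRight (Pi.single l (1 : ZMod 2)) v) i
          = (∑ i, d i * v i) + 1 := by
        simp [mul_add, Finset.sum_add_distrib, Pi.single_apply, hl1]
      rw [this, chi_add]
      have : chi 1 = -1 := by decide
      rw [this]; ring
    simp only [h2, Finset.sum_neg_distrib] at key
    linarith

lemma chi_sum {m : ℕ} (g : (Fin m → ZMod 2) → ZMod 2) :
    ∑ v, chi (g v) = 2 ^ m - 2 * (wt g : ℤ) := by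
  have h : ∀ v, chi (g v) = 1 - 2 * (if g v ≠ 0 then (1 : ℤ) else 0) := by
    intro v; unfold chi; split_ifs <;> simp_all
  simp only [h, Finset.sum_sub_distrib, ← Finset.mul_sum, Finset.sum_boole, wt]
  simp [ZMod.card]

lemma wt_zero_imp {m : ℕ} (g : (Fin m → ZMod 2) → ZMod 2) (h : wt g = 0) :
    ∀ v, g v = 0 := by
  intro v
  unfold wt at h
  rw [Finset.card_eq_zero, Finset.filter_eq_empty_iff] at h
  simpa using h (Finset.mem_univ v)

lemma wt_full_imp {m : ℕ} (g : (Fin m → ZMod 2) → ZMod 2) (h : wt g = 2 ^ m) :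
    ∀ v, g v = 1 := by
  intro v
  unfold wt at h
  have h' : (Finset.univ.filter fun i => g i ≠ 0).card
      = (Finset.univ : Finset (Fin m → ZMod 2)).card := by
    rw [h]; simp [ZMod.card]
  rw [Finset.card_filter_eq_iff] at h'
  have : ∀ x : ZMod 2, x ≠ 0 → x = 1 := by decide
  exact this _ (h' v (Finset.mem_univ v))

/-- the linear parametrisation of `RM1` -/
def rmMap (m : ℕ) : ((Fin m → ZMod 2) × ZMod 2) →ₗ[ZMod 2] ((Fin m → ZMod 2) → ZMod 2) where
  toFun p := fun v => (∑ i, p.1 i * v i) + p.2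
  map_add' p q := by
    funext v
    simp [add_mul, Finset.sum_add_distrib]; ring
  map_smul' c p := by
    funext v
    simp [mul_add, Finset.mul_sum, mul_assoc]

lemma exists_reps (m k : ℕ) (C : Submodule (ZMod 2) ((Fin m → ZMod 2) → ZMod 2))
    (hk : Module.finrank (ZMod 2) C = k) :
    ∃ f : Fin (2 ^ (k - m - 1)) → ((Fin m → ZMod 2) → ZMod 2),
      (∀ i, f i ∈ C) ∧ ∀ i j, i ≠ j → f i - f j ∉ LinearMap.range (rmMap m) := by
  set R := LinearMap.range (rmMap m) with hR
  let S : Submodule (ZMod 2) C := R.comap C.subtype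
  have h1 := Submodule.finrank_quotient_add_finrank S
  have h2 : Module.finrank (ZMod 2) S ≤ Module.finrank (ZMod 2) R := by
    let g : S →ₗ[ZMod 2] R :=
      (C.subtype.restrict (p := S) (q := R) (fun x hx => hx))
    apply LinearMap.finrank_le_finrank_of_injective (f := g)
    intro x y hxy
    have := congrArg Subtype.val hxy
    exact Subtype.ext (Subtype.ext this)
  have h3 : Module.finrank (ZMod 2) R ≤ m + 1 := by
    have := LinearMap.finrank_range_le (rmMap m)
    simpa using this
  have hq : Nat.card (C ⧸ S) = 2 ^ Module.finrank (ZMod 2) (C ⧸ S) := by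
    have := Module.natCard_eq_pow_finrank (K := ZMod 2) (V := C ⧸ S)
    simpa using this
  have : Finite (C ⧸ S) := Nat.finite_of_card_ne_zero (by rw [hq]; positivity)
  have : Fintype (C ⧸ S) := Fintype.ofFinite _
  obtain ⟨e⟩ : Nonempty (Fin (2 ^ (k - m - 1)) ↪ (C ⧸ S)) := by
    apply Function.Embedding.nonempty_of_card_le
    rw [Fintype.card_fin, ← Nat.card_eq_fintype_card, hq]
    exact Nat.pow_le_pow_right (by norm_num) (by omega)
  choose r hr using fun i => Submodule.Quotient.mk_surjective S (e i)
  refine ⟨fun i => (r i : (Fin m → ZMod 2) → ZMod 2), fun i => (r i).2, ?_⟩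
  intro i j hij hmem
  apply hij
  apply e.injective
  rw [← hr i, ← hr j, Submodule.Quotient.eq]
  exact hmem

theorem stmt0 (m k a : ℕ) (hm : 2 ≤ m)
    (C : Submodule (ZMod 2) ((Fin m → ZMod 2) → ZMod 2))
    (hC : SatCond m k a C) :
    ∃ H : Fin (2 ^ (k - m - 1)) → Matrix (Fin (2 ^ m)) (Fin (2 ^ m)) ℤ,
      (∀ i, IsHadamard (2 ^ m) (H i)) ∧
      ∀ i j, i ≠ j →
        ∃ W : Matrix (Fin (2 ^ m)) (Fin (2 ^ m)) ℤ,
          IsWeighing (2 ^ m) ((2 ^ m / (2 * a)) ^ 2) W ∧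
          H i * (H j).transpose = ((2 * a : ℕ) : ℤ) • W := by
  obtain ⟨hk, ha, ha2, hw, hRM⟩ := hC
  obtain ⟨f, hfC, hf⟩ := exists_reps m k C hk
  have hcard : Fintype.card (Fin (2 ^ m)) = Fintype.card (Fin m → ZMod 2) := by
    simp [ZMod.card]
  let e : Fin (2 ^ m) ≃ (Fin m → ZMod 2) := Fintype.equivOfCardEq hcard
  have dbl : ∀ x : ZMod 2, x + x = 0 := by decide
  have eqz : ∀ p q, e p + e q = 0 ↔ p = q := by
    intro p q
    constructor
    · intro h
      apply e.injective
      funext l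
      have h' := congrFun h l
      have : ∀ x y : ZMod 2, x + y = 0 → x = y := by decide
      exact this _ _ h'
    · rintro rfl
      funext l
      exact dbl _
  let H : Fin (2 ^ (k - m - 1)) → Matrix (Fin (2 ^ m)) (Fin (2 ^ m)) ℤ :=
    fun i p q => chi (f i (e q) + ∑ l, e p l * e q l)
  have hH : ∀ i p q, H i p q = chi (f i (e q) + ∑ l, e p l * e q l) := fun _ _ _ => rfl
  have hprod : ∀ i j p q, (H i * (H j).transpose) p q
      = ∑ v, chi (f i v - f j v + ∑ l, (e p + e q) l * v l) := by
    intro i j p q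
    rw [Matrix.mul_apply, ← Equiv.sum_comp e]
    refine Finset.sum_congr rfl fun x _ => ?_
    simp only [Matrix.transpose_apply, hH, ← chi_add, Pi.add_apply, add_mul,
      Finset.sum_add_distrib]
    congr 1
    rw [CharTwo.sub_eq_add]; ring
  have hHH : ∀ i, H i * (H i).transpose = (((2 ^ m : ℕ) : ℤ)) • 1 := by
    intro i
    ext p q
    rw [hprod]
    simp only [sub_self, zero_add, chi_orth, eqz]
    simp [Matrix.one_apply]
  have hHT : ∀ i, (H i).transpose * H i = (((2 ^ m : ℕ) : ℤ)) • 1 := by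
    intro i
    ext p q
    have : ((H i).transpose * H i) p q
        = chi (f i (e p)) * chi (f i (e q)) * ∑ v : Fin m → ZMod 2, chi (∑ l, (e p + e q) l * v l) := by
      rw [Matrix.mul_apply, ← Equiv.sum_comp e, Finset.mul_sum]
      refine Finset.sum_congr rfl fun x _ => ?_
      simp only [Matrix.transpose_apply, hH, ← chi_add, Pi.add_apply, add_mul,
        Finset.sum_add_distrib, mul_comm (e x _)]
      congr 1
      ring
    rw [this, chi_orth]
    simp only [eqz]
    by_cases h : p = q
    · subst h; simp [chi_sq]
    · simp [h]
  refine ⟨H, fun i => ⟨fun p q => chi_pm _, hHH i⟩, ?_⟩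
  intro i j hij
  have hval : ∀ p q, ∃ c : ℤ, (c = 0 ∨ c = 1 ∨ c = -1) ∧
      (H i * (H j).transpose) p q = ((2 * a : ℕ) : ℤ) * c := by
    intro p q
    let g : (Fin m → ZMod 2) → ZMod 2 := fun v => f i v - f j v + ∑ l, (e p + e q) l * v l
    have hgC : g ∈ C := by
      have h1 : (fun v => (∑ l, (e p + e q) l * v l) + 0) ∈ C :=
        hRM ⟨e p + e q, 0, rfl⟩
      have := C.add_mem (C.sub_mem (hfC i) (hfC j)) h1
      convert this using 1
      funext v
      simp [g]
    have hconst : ∀ b : ZMod 2, ¬ ∀ v, g v = b := by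
      intro b hb
      apply hf i j hij
      refine ⟨(e p + e q, b), ?_⟩
      funext v
      have h1 := hb v
      simp only [g] at h1
      show (∑ l, (e p + e q) l * v l) + b = f i v - f j v
      rw [← h1, add_comm, add_assoc, dbl, add_zero]
    have hwg : wt g ∈ ({0, 2 ^ m / 2 - a, 2 ^ m / 2, 2 ^ m / 2 + a, 2 ^ m} : Set ℕ) := by
      rw [← hw]; exact ⟨g, hgC, rfl⟩
    have heven : 2 ^ m / 2 * 2 = 2 ^ m :=
      Nat.div_mul_cancel (dvd_pow_self 2 (by omega))
    have hs : (H i * (H j).transpose) p q = 2 ^ m - 2 * (wt g : ℤ) := by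
      rw [hprod]; exact chi_sum g
    have hev : ((2 ^ m / 2 : ℕ) : ℤ) * 2 = 2 ^ m := by exact_mod_cast heven
    rw [hs]
    generalize 2 ^ m / 2 = N at *
    simp only [Set.mem_insert_iff, Set.mem_singleton_iff] at hwg
    rcases hwg with h | h | h | h | h
    · exact absurd (wt_zero_imp g h) (hconst 0)
    · refine ⟨1, by simp, ?_⟩
      rw [h, Nat.cast_sub ha2.le]; push_cast; linarith
    · refine ⟨0, by simp, ?_⟩
      rw [h]; linarith
    · refine ⟨-1, by simp, ?_⟩
      rw [h]; push_cast; linarith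
    · exact absurd (wt_full_imp g h) (hconst 1)
  choose c hc hcv using hval
  let W : Matrix (Fin (2 ^ m)) (Fin (2 ^ m)) ℤ := c
  have hW : H i * (H j).transpose = ((2 * a : ℕ) : ℤ) • W := by
    ext p q
    rw [hcv]; rfl
  have hsq : ((2 * a : ℕ) : ℤ) ^ 2 • (W * W.transpose)
      = (((2 ^ m : ℕ) : ℤ)) ^ 2 • (1 : Matrix (Fin (2 ^ m)) (Fin (2 ^ m)) ℤ) := by
    have h1 : (H i * (H j).transpose) * (H i * (H j).transpose).transpose
        = (((2 ^ m : ℕ) : ℤ)) ^ 2 • (1 : Matrix (Fin (2 ^ m)) (Fin (2 ^ m)) ℤ) := by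
      rw [Matrix.transpose_mul, Matrix.transpose_transpose, Matrix.mul_assoc,
        ← Matrix.mul_assoc (H j).transpose, hHT j, Matrix.smul_mul, Matrix.one_mul,
        Matrix.mul_smul, hHH i, smul_smul, sq]
    rw [← h1, hW, Matrix.transpose_smul, Matrix.smul_mul, Matrix.mul_smul, smul_smul, sq]
  have hdvd : 2 * a ∣ 2 ^ m := by
    let p : Fin (2 ^ m) := ⟨0, by positivity⟩
    have h := congrFun (congrFun hsq p) p
    simp only [Matrix.smul_apply, Matrix.one_apply_eq, smul_eq_mul, mul_one] at h
    have h2 : ((2 * a : ℕ) : ℤ) ^ 2 ∣ ((2 ^ m : ℕ) : ℤ) ^ 2 := ⟨_, h.symm⟩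
    rw [Int.pow_dvd_pow_iff (by norm_num)] at h2
    exact_mod_cast h2
  refine ⟨W, ⟨hc, ?_⟩, hW⟩
  obtain ⟨t, ht⟩ := hdvd
  have ht' : 2 ^ m / (2 * a) = t := by
    rw [ht]; exact Nat.mul_div_cancel_left _ (by omega)
  rw [ht']
  ext p q
  have h := congrFun (congrFun hsq p) q
  have h2a : (((2 * a : ℕ) : ℤ)) ^ 2 ≠ 0 := by positivity
  apply mul_left_cancel₀ h2a
  have htz : ((2 ^ m : ℕ) : ℤ) = ((2 * a : ℕ) : ℤ) * t := by exact_mod_cast ht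
  simp only [Matrix.smul_apply, smul_eq_mul] at h ⊢
  rw [h, htz]
  push_cast
  ring
end

section
/- Let m ≥ 2 be an integer, n = 2^m, and let C be a binary [n,k] code satisfying the conditions (C1) and (C2) with respect to a positive integer a, and set l = (n/(2a))^2. Then the weight distribution of C is given by A_0(C) = 1, A_{n/2−a}(C) = (2^(k−m−1) − 1)·l, A_{n/2}(C) = 2n − 2 + (2^(k−m−1) − 1)(2n − 2l), A_{n/2+a}(C) = (2^(k−m−1) − 1)·l, A_n(C) = 1, and A_i(C) = 0 for all other i. -/
open Finset

/-- sign character -/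
def sg (x : ZMod 2) : ℤ := if x = 0 then 1 else -1

lemma sg_add (x y : ZMod 2) : sg (x + y) = sg x * sg y := by
  revert x y; decide

lemma sg_sq (x : ZMod 2) : sg x * sg x = 1 := by
  revert x; decide

lemma sg_sum_zero {G : Type*} [AddGroup G] [Fintype G] (φ : G → ZMod 2)
    (hφ : ∀ x y, φ (x + y) = φ x + φ y) (g : G) (hg : φ g ≠ 0) :
    ∑ x, sg (φ x) = 0 := by
  have h : ∑ x, sg (φ (x + g)) = ∑ x, sg (φ x) :=
    Equiv.sum_comp (Equiv.addRight g) (fun x => sg (φ x))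
  have h2 : ∀ x, sg (φ (x + g)) = - sg (φ x) := by
    intro x
    rw [hφ, sg_add]
    simp [sg, hg]
  simp only [h2, Finset.sum_neg_distrib] at h
  omega

/-- Walsh sum -/
def Wal {ι : Type*} [Fintype ι] (x : ι → ZMod 2) : ℤ := ∑ v, sg (x v)

lemma Wal_eq {ι : Type*} [Fintype ι] (x : ι → ZMod 2) :
    Wal x = Fintype.card ι - 2 * wt x := by
  have : ∀ v, sg (x v) = 1 - 2 * (if x v ≠ 0 then 1 else 0) := by
    intro v
    by_cases h : x v = 0 <;> simp [sg, h]
  simp only [Wal, this, wt, Finset.sum_sub_distrib, ← Finset.mul_sum, Finset.sum_boole]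
  simp

lemma parseval {ι T : Type*} [Fintype ι] [Fintype T] [DecidableEq ι] (f : T → ι → ZMod 2)
    (h : ∀ v w, v ≠ w → ∑ t, sg (f t v) * sg (f t w) = 0) :
    ∑ t, Wal (f t) ^ 2 = Fintype.card T * Fintype.card ι := by
  have : ∀ t, Wal (f t) ^ 2 = ∑ v, ∑ w, sg (f t v) * sg (f t w) := by
    intro t
    rw [sq, Wal, Finset.sum_mul_sum]
  simp only [this]
  rw [Finset.sum_comm]
  have h2 : ∀ v, ∑ t, ∑ w, sg (f t v) * sg (f t w) = (Fintype.card T : ℤ) := by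
    intro v
    rw [Finset.sum_comm, Finset.sum_eq_single v]
    · simp [sg_sq]
    · intro w _ hw
      exact h v w hw.symm
    · simp
  simp only [h2]
  simp [mul_comm]

lemma exists_sep {m : ℕ} (v w : Fin m → ZMod 2) (h : v ≠ w) :
    ∃ u : Fin m → ZMod 2, (∑ i, u i * v i) + (∑ i, u i * w i) ≠ 0 := by
  obtain ⟨j, hj⟩ := Function.ne_iff.mp h
  refine ⟨Pi.single j 1, ?_⟩
  simp only [Pi.single_apply, ite_mul, one_mul, zero_mul, Finset.sum_ite_eq', Finset.mem_univ,
    if_true]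
  revert hj
  generalize v j = p
  generalize w j = q
  revert p q
  decide

lemma coset_parseval {m : ℕ} (x : (Fin m → ZMod 2) → ZMod 2) :
    ∑ u : Fin m → ZMod 2, Wal (fun v => x v + ((∑ i, u i * v i) + 0)) ^ 2 = (2 ^ m) * 2 ^ m := by
  rw [parseval]
  · simp [ZMod.card]
  · intro v w hvw
    obtain ⟨g, hg⟩ := exists_sep v w hvw
    have := sg_sum_zero (fun u : Fin m → ZMod 2 => (∑ i, u i * v i) + (∑ i, u i * w i))
      (by
        intro a b
        simp only [Pi.add_apply, add_mul, Finset.sum_add_distrib]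
        ring) g hg
    simp only [sg_add] at this
    calc _ = ∑ u : Fin m → ZMod 2, (sg (x v) * sg (x w)) *
        (sg (∑ i, u i * v i) * sg (∑ i, u i * w i)) := by
          refine Finset.sum_congr rfl fun u _ => ?_
          simp only [add_zero, sg_add]
          ring
      _ = 0 := by rw [← Finset.mul_sum, this, mul_zero]

lemma code_parseval {m : ℕ} (C : Submodule (ZMod 2) ((Fin m → ZMod 2) → ZMod 2)) [Fintype C]
    (hR : RM1 m ⊆ (C : Set ((Fin m → ZMod 2) → ZMod 2))) :
    ∑ x : C, Wal (x : (Fin m → ZMod 2) → ZMod 2) ^ 2 = Fintype.card C * 2 ^ m := by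
  rw [parseval (fun x : C => (x : (Fin m → ZMod 2) → ZMod 2))]
  · simp [ZMod.card]
  · intro v w hvw
    obtain ⟨g, hg⟩ := exists_sep v w hvw
    have hgC : (fun v => (∑ i, g i * v i) + 0) ∈ C := hR ⟨g, 0, rfl⟩
    have := sg_sum_zero (fun x : C => x.1 v + x.1 w)
      (by
        intro a b
        simp only [Submodule.coe_add, Pi.add_apply]
        ring) ⟨_, hgC⟩ (by simpa using hg)
    simpa only [sg_add] using this

lemma Ai_eq {m : ℕ} (C : Submodule (ZMod 2) ((Fin m → ZMod 2) → ZMod 2)) [Fintype C] (i : ℕ) :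
    Ai (↑C : Set ((Fin m → ZMod 2) → ZMod 2)) i =
      ((Finset.univ : Finset C).filter fun x => wt x.1 = i).card := by
  have : {x ∈ (C : Set ((Fin m → ZMod 2) → ZMod 2)) | wt x = i} =
      (((Finset.univ : Finset C).filter fun x => wt x.1 = i).map
        (Function.Embedding.subtype _) : Finset ((Fin m → ZMod 2) → ZMod 2)) := by
    ext x
    simp [and_comm]
  rw [Ai, this, Set.ncard_coe_finset, Finset.card_map]

lemma wt_add_one {ι : Type*} [Fintype ι] (x : ι → ZMod 2) :
    (wt (x + fun _ => 1) : ℤ) = Fintype.card ι - wt x := by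
  have h1 := Wal_eq x
  have h2 := Wal_eq (x + fun _ => 1)
  have h3 : Wal (x + fun _ => 1) = - Wal x := by
    simp only [Wal, Pi.add_apply, sg_add, ← Finset.sum_neg_distrib]
    refine Finset.sum_congr rfl fun v _ => ?_
    have : sg 1 = -1 := by decide
    rw [this]; ring
  omega

/-- the weight distribution of a code satisfying (C1) and (C2). -/
theorem stmt3 (m k a : ℕ) (hm : 2 ≤ m)
    (C : Submodule (ZMod 2) ((Fin m → ZMod 2) → ZMod 2))
    (hC : SatCond m k a C)
    (l : ℕ) (hl : l = (2 ^ m / (2 * a)) ^ 2) :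
    Ai (↑C : Set ((Fin m → ZMod 2) → ZMod 2)) 0 = 1 ∧
    Ai (↑C : Set ((Fin m → ZMod 2) → ZMod 2)) (2 ^ m / 2 - a) = (2 ^ (k - m - 1) - 1) * l ∧
    (Ai (↑C : Set ((Fin m → ZMod 2) → ZMod 2)) (2 ^ m / 2) : ℤ) =
      2 * 2 ^ m - 2 + ((2 : ℤ) ^ (k - m - 1) - 1) * (2 * 2 ^ m - 2 * l) ∧
    Ai (↑C : Set ((Fin m → ZMod 2) → ZMod 2)) (2 ^ m / 2 + a) = (2 ^ (k - m - 1) - 1) * l ∧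
    Ai (↑C : Set ((Fin m → ZMod 2) → ZMod 2)) (2 ^ m) = 1 ∧
    ∀ i : ℕ, i ∉ ({0, 2 ^ m / 2 - a, 2 ^ m / 2, 2 ^ m / 2 + a, 2 ^ m} : Set ℕ) →
      Ai (↑C : Set ((Fin m → ZMod 2) → ZMod 2)) i = 0 := by
  classical
  obtain ⟨hk, ha, han, hW, hR⟩ := hC
  have : Fintype C := Fintype.ofFinite C
  obtain ⟨h, hh⟩ : ∃ h, 2 ^ m = 2 * h := ⟨2 ^ (m - 1), by
    rw [← pow_succ']; congr 1; omega⟩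
  have hh2 : 2 ^ m / 2 = h := by omega
  have hhZ : (2 : ℤ) ^ m = 2 * h := by exact_mod_cast hh
  have hcardι : Fintype.card (Fin m → ZMod 2) = 2 * h := by simp [ZMod.card, hh]
  have hcardC : Fintype.card C = 2 ^ k := by
    rw [Module.card_eq_pow_finrank (K := ZMod 2), hk, ZMod.card]
  have hwts : ∀ x ∈ C, wt x = 0 ∨ wt x = h - a ∨ wt x = h ∨ wt x = h + a ∨ wt x = 2 * h := by
    intro x hx
    have : wt x ∈ {w : ℕ | ∃ x ∈ C, wt x = w} := ⟨x, hx, rfl⟩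
    rw [hW, hh2, hh] at this
    simpa using this
  rw [hh2] at han
  -- zero
  have hA0 : Ai (↑C : Set ((Fin m → ZMod 2) → ZMod 2)) 0 = 1 := by
    rw [Ai, Set.ncard_eq_one]
    refine ⟨0, ?_⟩
    ext x
    simp only [Set.mem_setOf_eq, Set.mem_singleton_iff, SetLike.mem_coe, wt, Finset.card_eq_zero,
      Finset.filter_eq_empty_iff]
    constructor
    · rintro ⟨_, hx⟩
      funext v
      simpa using hx (Finset.mem_univ v)
    · rintro rfl
      simp
  have h1C : (fun _ => 1 : (Fin m → ZMod 2) → ZMod 2) ∈ C := hR ⟨0, 1, by simp⟩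
  have hsymm : ∀ i ≤ 2 * h, Ai (↑C : Set ((Fin m → ZMod 2) → ZMod 2)) (2 * h - i) =
      Ai (↑C : Set ((Fin m → ZMod 2) → ZMod 2)) i := by
    intro i hi
    rw [Ai_eq, Ai_eq]
    refine Finset.card_equiv (Equiv.addRight (⟨_, h1C⟩ : C)) ?_
    intro x
    have := wt_add_one x.1
    rw [hcardι] at this
    simp only [Finset.mem_filter, Finset.mem_univ, true_and, Equiv.coe_addRight,
      Submodule.coe_add]
    omega
  have hA1 : Ai (↑C : Set ((Fin m → ZMod 2) → ZMod 2)) (2 * h) = 1 := by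
    have := hsymm 0 (by omega)
    simpa [hA0] using this
  have hAs : Ai (↑C : Set ((Fin m → ZMod 2) → ZMod 2)) (h + a) =
      Ai (↑C : Set ((Fin m → ZMod 2) → ZMod 2)) (h - a) := by
    rw [← hsymm (h - a) (by omega)]
    congr 1; omega
  have hother : ∀ i : ℕ, i ∉ ({0, 2 ^ m / 2 - a, 2 ^ m / 2, 2 ^ m / 2 + a, 2 ^ m} : Set ℕ) →
      Ai (↑C : Set ((Fin m → ZMod 2) → ZMod 2)) i = 0 := by
    intro i hi
    rw [← hW] at hi
    rw [Ai, Set.ncard_eq_zero]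
    ext x
    simp only [Set.mem_setOf_eq, Set.mem_empty_iff_false, iff_false]
    rintro ⟨h1, h2⟩
    exact hi ⟨x, h1, h2⟩
  -- a codeword of weight h - a
  obtain ⟨x, hx, hxw⟩ : ∃ x ∈ C, wt x = h - a := by
    have : h - a ∈ {w : ℕ | ∃ x ∈ C, wt x = w} := by
      rw [hW, hh2]; simp
    exact this
  have hWal : ∀ y : (Fin m → ZMod 2) → ZMod 2, Wal y = 2 * h - 2 * wt y := by
    intro y; rw [Wal_eq, hcardι]; push_cast; ring
  have hdvd : 2 * a ∣ 2 ^ m := by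
    have hP := coset_parseval x
    rw [hhZ] at hP
    have hx0 : Wal (fun v : Fin m → ZMod 2 =>
        x v + ((∑ i, (0 : Fin m → ZMod 2) i * v i) + 0)) = 2 * a := by
      have : (fun v : Fin m → ZMod 2 =>
        x v + ((∑ i, (0 : Fin m → ZMod 2) i * v i) + 0)) = x := by simp
      rw [this, hWal, hxw]; omega
    have key : ∀ u : Fin m → ZMod 2, ((2 * a : ℤ)) ^ 2 ∣
        Wal (fun v : Fin m → ZMod 2 => x v + ((∑ i, u i * v i) + 0)) ^ 2 := by
      intro u
      by_cases hu : u = 0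
      · subst hu
        rw [hx0]
      have hmem : (fun v : Fin m → ZMod 2 => x v + ((∑ i, u i * v i) + 0)) ∈ C :=
        C.add_mem hx (hR ⟨u, 0, rfl⟩)
      have hle : Wal (fun v : Fin m → ZMod 2 => x v + ((∑ i, u i * v i) + 0)) ^ 2 + (2 * a) ^ 2
          ≤ 2 * h * (2 * h) := by
        rw [← hP, ← hx0]
        exact Finset.add_le_sum (f := fun u : Fin m → ZMod 2 =>
          Wal (fun v : Fin m → ZMod 2 => x v + ((∑ i, u i * v i) + 0)) ^ 2)
          (fun i _ => sq_nonneg _) (Finset.mem_univ u) (Finset.mem_univ 0) hu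
      have hapos : (0 : ℤ) < (2 * a) ^ 2 := by positivity
      have h5 := hwts _ hmem
      rw [hWal] at hle ⊢
      rcases h5 with e | e | e | e | e
      · rw [e] at hle; exfalso; push_cast at hle; nlinarith
      · rw [e]; push_cast [han.le]; exact dvd_of_eq (by ring)
      · rw [e]; simp
      · rw [e]; push_cast; exact dvd_of_eq (by ring)
      · rw [e] at hle; exfalso; push_cast at hle; nlinarith
    have hd := Finset.dvd_sum (s := Finset.univ) (fun u _ => key u)
    rw [hP, ← sq] at hd
    have hd2 : (2 * a) ^ 2 ∣ (2 * h) ^ 2 := by exact_mod_cast hd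
    rw [hh]
    exact (Nat.pow_dvd_pow_iff (by norm_num)).mp hd2
  -- moments
  have hind : ∀ i : ℕ, (Ai (↑C : Set ((Fin m → ZMod 2) → ZMod 2)) i : ℤ) =
      ∑ x : C, if wt x.1 = i then 1 else 0 := by
    intro i
    rw [Ai_eq, Finset.sum_boole]
  have hM0 : (2 : ℤ) ^ k = Ai (↑C : Set ((Fin m → ZMod 2) → ZMod 2)) 0 +
      Ai (↑C : Set ((Fin m → ZMod 2) → ZMod 2)) (h - a) +
      Ai (↑C : Set ((Fin m → ZMod 2) → ZMod 2)) h +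
      Ai (↑C : Set ((Fin m → ZMod 2) → ZMod 2)) (h + a) +
      Ai (↑C : Set ((Fin m → ZMod 2) → ZMod 2)) (2 * h) := by
    simp only [hind, ← Finset.sum_add_distrib]
    have : (2 : ℤ) ^ k = ∑ x : C, 1 := by simp [hcardC]
    rw [this]
    refine Finset.sum_congr rfl fun x _ => ?_
    have := hwts x.1 x.2
    split_ifs <;> omega
  have hM2 : (2 : ℤ) ^ k * (2 * h) =
      (2 * h) ^ 2 * Ai (↑C : Set ((Fin m → ZMod 2) → ZMod 2)) 0 +
      (2 * a) ^ 2 * Ai (↑C : Set ((Fin m → ZMod 2) → ZMod 2)) (h - a) +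
      (2 * a) ^ 2 * Ai (↑C : Set ((Fin m → ZMod 2) → ZMod 2)) (h + a) +
      (2 * h) ^ 2 * Ai (↑C : Set ((Fin m → ZMod 2) → ZMod 2)) (2 * h) := by
    have hP := code_parseval C hR
    rw [hcardC, hhZ] at hP
    push_cast at hP
    rw [← hP]
    simp only [hind, Finset.mul_sum, ← Finset.sum_add_distrib]
    refine Finset.sum_congr rfl fun x _ => ?_
    rw [hWal]
    have hz : h ≠ 0 := by omega
    have hz2 : h - a ≠ 0 := by omega
    have hz3 : h ≠ h - a := by omega
    have hz4 : h + a ≠ h - a := by omega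
    have hz5 : 2 * h ≠ h - a := by omega
    have hz6 : 2 * h ≠ h + a := by omega
    have hz7 : h ≠ 2 * h := by omega
    have hc : ((h - a : ℕ) : ℤ) = h - a := by push_cast [han.le]; ring
    rcases hwts x.1 x.2 with e | e | e | e | e <;> rw [e]
    · rw [if_pos rfl, if_neg (by omega), if_neg (by omega), if_neg (by omega)]; push_cast; ring
    · rw [if_neg (by omega), if_pos rfl, if_neg (by omega), if_neg (by omega), hc]; ring
    · rw [if_neg (by omega), if_neg (by omega), if_neg (by omega), if_neg (by omega)]; ring
    · rw [if_neg (by omega), if_neg (by omega), if_pos rfl, if_neg (by omega)]; push_cast; ring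
    · rw [if_neg (by omega), if_neg (by omega), if_neg (by omega), if_pos rfl]; push_cast; ring
  have hApos : 0 < Ai (↑C : Set ((Fin m → ZMod 2) → ZMod 2)) (h - a) := by
    rw [Ai, Set.ncard_pos]
    exact ⟨x, hx, hxw⟩
  rw [hh2, hA0, hAs]
  rw [hA0, hAs, hA1] at hM0 hM2
  generalize Ai (↑C : Set ((Fin m → ZMod 2) → ZMod 2)) (h - a) = A at *
  generalize hB : Ai (↑C : Set ((Fin m → ZMod 2) → ZMod 2)) h = B at *
  obtain ⟨q, hq⟩ := hdvd
  have hlq : l = q ^ 2 := by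
    rw [hl, hq, Nat.mul_div_cancel_left _ (by omega)]
  have hhq : (h : ℤ) = a * q := by
    have : 2 * h = 2 * (a * q) := by rw [← hh, hq]; ring
    have : h = a * q := by omega
    exact_mod_cast this
  have haZ : (0 : ℤ) < a := by exact_mod_cast ha
  have hhpos : (0 : ℤ) < h := by exact_mod_cast (by omega : 0 < h)
  have hAZ : (0 : ℤ) < A := by exact_mod_cast hApos
  have hkm : m + 1 < k := by
    by_contra hcon
    have h1 : 2 ^ k ≤ 2 ^ (m + 1) := Nat.pow_le_pow_right (by norm_num) (by omega)
    rw [pow_succ, hh] at h1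
    have h2 : (2 : ℤ) ^ k ≤ 2 * h * 2 := by exact_mod_cast h1
    have h3 : (2 : ℤ) ^ k * (2 * h) ≤ 2 * h * 2 * (2 * h) :=
      mul_le_mul_of_nonneg_right h2 (by positivity)
    have h4 : (0 : ℤ) < (2 * a) ^ 2 * A := by positivity
    push_cast at hM2
    nlinarith
  have hksplit : (2 : ℤ) ^ k = 2 ^ (k - m - 1) * (4 * h) := by
    have : k = (k - m - 1) + (m + 1) := by omega
    conv_lhs => rw [this, pow_add, pow_succ, hhZ]
    ring
  have hp1 : 1 ≤ 2 ^ (k - m - 1) := Nat.one_le_two_pow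
  have hAval : (A : ℤ) = (2 ^ (k - m - 1) - 1) * l := by
    rw [hksplit] at hM2
    push_cast at hM2
    have h8 : (8 * a ^ 2 : ℤ) ≠ 0 := by positivity
    apply mul_left_cancel₀ h8
    rw [hlq]
    push_cast
    rw [hhq] at hM2
    linear_combination -hM2
  have hAnat : A = (2 ^ (k - m - 1) - 1) * l := by
    zify [hp1]
    exact hAval
  refine ⟨rfl, hAnat, ?_, hAnat, ?_, ?_⟩
  · rw [hhZ]
    rw [hksplit] at hM0
    push_cast at hM0
    linear_combination -hM0 - 2 * hAval
  · rw [hh]; exact hA1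
  · rw [hh2] at hother; exact hother
end

section
/- Let m ≥ 2 be an integer and n = 2^m. If there exists a binary [n,k] code satisfying the conditions (C1) and (C2) with respect to a positive integer a, then a divides 2^(m−1). -/
open Finset

/-- The sign character of `ZMod 2`. -/
def sgnZ (z : ZMod 2) : ℤ := if z = 0 then 1 else -1

lemma sgnZ_add : ∀ x y : ZMod 2, sgnZ (x + y) = sgnZ x * sgnZ y := by decide

lemma sgnZ_sum {ι : Type*} (s : Finset ι) (f : ι → ZMod 2) :
    sgnZ (∑ i ∈ s, f i) = ∏ i ∈ s, sgnZ (f i) := by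
  classical
  induction s using Finset.induction_on with
  | empty => simp [sgnZ]
  | insert a s ha ih => rw [Finset.sum_insert ha, Finset.prod_insert ha, sgnZ_add, ih]

lemma sgnZ_orth1 : ∀ z : ZMod 2, ∑ c : ZMod 2, sgnZ (c * z) = if z = 0 then 2 else 0 := by
  decide

lemma sgnZ_orth (m : ℕ) (z : Fin m → ZMod 2) :
    ∑ u : Fin m → ZMod 2, sgnZ (∑ i, u i * z i) = if z = 0 then 2 ^ m else 0 := by
  simp_rw [sgnZ_sum]
  rw [← Fintype.prod_sum (fun i c => sgnZ (c * z i))]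
  simp_rw [sgnZ_orth1]
  split_ifs with h
  · subst h; simp
  · obtain ⟨i, hi⟩ := Function.ne_iff.mp h
    exact Finset.prod_eq_zero (Finset.mem_univ i) (if_neg hi)

lemma sgnZ_wt {ι : Type*} [Fintype ι] (x : ι → ZMod 2) :
    ∑ v, sgnZ (x v) = (Fintype.card ι : ℤ) - 2 * (wt x : ℤ) := by
  have h : ∀ v, sgnZ (x v) = 1 - 2 * (if x v ≠ 0 then 1 else 0) := by
    intro v; unfold sgnZ; split_ifs <;> simp_all
  simp_rw [h]
  rw [Finset.sum_sub_distrib, ← Finset.mul_sum, Finset.sum_boole]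
  simp [wt]

lemma sgnZ_pars (m : ℕ) (x : (Fin m → ZMod 2) → ZMod 2) :
    ∑ u : Fin m → ZMod 2, (∑ v, sgnZ (x v + ∑ i, u i * v i)) ^ 2 = (2 ^ m) ^ 2 := by
  have h : ∀ u : Fin m → ZMod 2, (∑ v, sgnZ (x v + ∑ i, u i * v i)) ^ 2
      = ∑ v, ∑ w, sgnZ (x v + x w) * sgnZ (∑ i, u i * (v + w) i) := by
    intro u
    rw [sq, Finset.sum_mul_sum]
    refine Finset.sum_congr rfl fun v _ => Finset.sum_congr rfl fun w _ => ?_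
    rw [← sgnZ_add, ← sgnZ_add]
    congr 1
    simp only [Pi.add_apply, mul_add, Finset.sum_add_distrib]
    ring
  simp_rw [h]
  rw [Finset.sum_comm]
  have h2 : ∀ v : Fin m → ZMod 2,
      ∑ u : Fin m → ZMod 2, ∑ w, sgnZ (x v + x w) * sgnZ (∑ i, u i * (v + w) i) = 2 ^ m := by
    intro v
    rw [Finset.sum_comm]
    simp_rw [← Finset.mul_sum, sgnZ_orth]
    rw [Finset.sum_eq_single v]
    · have h0 : v + v = 0 := by funext i; exact CharTwo.add_self_eq_zero _
      rw [if_pos h0, CharTwo.add_self_eq_zero]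
      simp [sgnZ]
    · intro w _ hw
      rw [if_neg, mul_zero]
      intro h0
      apply hw
      funext i
      have := congrFun h0 i
      exact (CharTwo.add_eq_zero.mp this).symm
    · simp
  simp_rw [h2]
  simp [ZMod.card, sq]

/-- if there exists a code of length `2^m` satisfying (C1) and (C2)
with respect to `a`, then `a` divides `2^(m-1)`. -/
theorem stmt5 (m k a : ℕ) (hm : 2 ≤ m)
    (C : Submodule (ZMod 2) ((Fin m → ZMod 2) → ZMod 2))
    (hC : SatCond m k a C) :
    a ∣ 2 ^ (m - 1) := by
  obtain ⟨-, ha, han, hw, hRM⟩ := hC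
  obtain ⟨x, hxC, hx⟩ : ∃ x ∈ C, wt x = 2 ^ m / 2 - a := by
    have : 2 ^ m / 2 - a ∈ {w : ℕ | ∃ x ∈ C, wt x = w} := by rw [hw]; simp
    exact this
  have hpow : 2 ^ m = 2 * 2 ^ (m - 1) := by
    rw [← pow_succ']; congr 1; omega
  have hhalf : 2 ^ m / 2 = 2 ^ (m - 1) := by omega
  rw [hhalf] at han hw hx
  set N := 2 ^ (m - 1) with hN
  have hpowZ : (2 : ℤ) ^ m = 2 * (N : ℤ) := by exact_mod_cast hpow
  have hpars := sgnZ_pars m x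
  rw [hpowZ] at hpars
  set W : (Fin m → ZMod 2) → ℤ := fun u => ∑ v, sgnZ (x v + ∑ i, u i * v i) with hW
  have hcard : (Fintype.card (Fin m → ZMod 2) : ℤ) = 2 * N := by
    rw [← hpowZ]; simp [ZMod.card]
  have hW0 : W 0 = 2 * a := by
    simp only [hW, Pi.zero_apply, zero_mul, Finset.sum_const_zero, add_zero]
    rw [sgnZ_wt, hcard, hx]
    push_cast [han.le]
    ring
  have hWu : ∀ u, W u ^ 2 = 0 ∨ W u ^ 2 = (2 * a) ^ 2 ∨ W u ^ 2 = (2 * N) ^ 2 := by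
    intro u
    have hmem : (fun v => x v + ∑ i, u i * v i) ∈ C := by
      refine C.add_mem hxC (hRM ⟨u, 0, ?_⟩)
      funext v; simp
    have h1 : wt (fun v => x v + ∑ i, u i * v i) ∈ {w : ℕ | ∃ x ∈ C, wt x = w} :=
      ⟨_, hmem, rfl⟩
    have h2 : W u = 2 * N - 2 * (wt (fun v => x v + ∑ i, u i * v i) : ℤ) := by
      rw [← hcard, ← sgnZ_wt]
    rw [hw, hpow] at h1
    simp only [Set.mem_insert_iff, Set.mem_singleton_iff] at h1
    rw [h2]
    rcases h1 with h | h | h | h | h <;> rw [h] <;> push_cast [han.le]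
    · right; right; ring
    · right; left; ring
    · left; ring
    · right; left; ring
    · right; right; ring
  have hdvd : ∀ u, ((2 * a : ℤ)) ^ 2 ∣ W u ^ 2 := by
    intro u
    rcases hWu u with h | h | h
    · rw [h]; exact dvd_zero _
    · rw [h]
    · exfalso
      have haZ : (0 : ℤ) < a := by exact_mod_cast ha
      have hanZ : (a : ℤ) < N := by exact_mod_cast han
      have hu : u ≠ 0 := by
        rintro rfl
        rw [hW0] at h
        nlinarith
      have hle : ∑ t ∈ ({u, 0} : Finset (Fin m → ZMod 2)), W t ^ 2 ≤ ∑ t, W t ^ 2 :=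
        Finset.sum_le_sum_of_subset_of_nonneg (Finset.subset_univ _)
          (fun _ _ _ => sq_nonneg _)
      rw [Finset.sum_pair hu, h, hW0, hpars] at hle
      nlinarith
  have hfin : (2 * a : ℤ) ^ 2 ∣ (2 * N) ^ 2 := by
    rw [← hpars]
    exact Finset.dvd_sum fun u _ => hdvd u
  have h3 : (2 * a : ℤ) ∣ 2 * N := (Int.pow_dvd_pow_iff (by norm_num)).mp hfin
  have h4 : (a : ℤ) ∣ N := (mul_dvd_mul_iff_left (by norm_num)).mp h3
  exact_mod_cast h4
end

section
/- There exists a binary [8,5] code satisfying the conditions (C1) and (C2) (with m = 3, n = 8), and any two binary [8,5] codes satisfying the conditions (C1) and (C2) are equivalent. Moreover, for any such code C, the set of weights of codewords of C is exactly {0, 2, 4, 6, 8} (i.e., a = 2). -/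
open Finset

abbrev V3 := Fin 3 → ZMod 2

/-- affine function -/
def aff (a : V3) (b : ZMod 2) : V3 → ZMod 2 := fun v => (∑ i, a i * v i) + b

/-- a word given by its eight values -/
def word (x0 x1 x2 x3 x4 x5 x6 x7 : ZMod 2) : V3 → ZMod 2 := fun v =>
  if v 0 = 0 then
    (if v 1 = 0 then (if v 2 = 0 then x0 else x1) else (if v 2 = 0 then x2 else x3))
  else
    (if v 1 = 0 then (if v 2 = 0 then x4 else x5) else (if v 2 = 0 then x6 else x7))

lemma word_surj (x : V3 → ZMod 2) : ∃ x0 x1 x2 x3 x4 x5 x6 x7,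
    x = word x0 x1 x2 x3 x4 x5 x6 x7 := by
  refine ⟨x ![0,0,0], x ![0,0,1], x ![0,1,0], x ![0,1,1], x ![1,0,0], x ![1,0,1],
    x ![1,1,0], x ![1,1,1], ?_⟩
  funext v
  have key : ∀ z : ZMod 2, z = 0 ∨ z = 1 := by decide
  have hv : v = ![v 0, v 1, v 2] := by
    funext i; fin_cases i <;> rfl
  unfold word
  rw [hv]
  rcases key (v 0) with h0 | h0 <;> rcases key (v 1) with h1 | h1 <;>
    rcases key (v 2) with h2 | h2 <;> simp [h0, h1, h2]

lemma word_dec : ∀ x0 x1 x2 x3 x4 x5 x6 x7 : ZMod 2,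
    (wt (word x0 x1 x2 x3 x4 x5 x6 x7) = 3 →
      ∃ a b, wt (word x0 x1 x2 x3 x4 x5 x6 x7 + aff a b) = 1) ∧
    (wt (word x0 x1 x2 x3 x4 x5 x6 x7) = 1 →
      ∃ a b, wt (word x0 x1 x2 x3 x4 x5 x6 x7 + aff a b) = 3) := by
  decide +kernel

lemma wt_dec (x : V3 → ZMod 2) :
    (wt x = 3 → ∃ a b, wt (x + aff a b) = 1) ∧
    (wt x = 1 → ∃ a b, wt (x + aff a b) = 3) := by
  obtain ⟨x0, x1, x2, x3, x4, x5, x6, x7, rfl⟩ := word_surj x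
  exact word_dec x0 x1 x2 x3 x4 x5 x6 x7

lemma aff_wt : ∀ a b, wt (aff a b) ≠ 2 := by decide +kernel

lemma aff_zero : ∀ a b, aff a b = 0 → a = 0 ∧ b = 0 := by decide +kernel

lemma fun_dec : ∀ d d' : V3, d ≠ 0 → d' ≠ 0 →
    ∃ c : V3, ∑ i, c i * d i = 1 ∧ ∑ i, c i * d' i = 1 := by decide +kernel

/-- parametrisation of the code spanned by `RM(1,3)` and `g` -/
def psi (g : V3 → ZMod 2) : (V3 × ZMod 2) × ZMod 2 →ₗ[ZMod 2] (V3 → ZMod 2) where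
  toFun t := aff t.1.1 t.1.2 + t.2 • g
  map_add' s t := by
    funext v
    simp only [aff, Prod.fst_add, Prod.snd_add, Pi.add_apply, Pi.smul_apply, smul_eq_mul,
      Fin.sum_univ_three]
    ring
  map_smul' r t := by
    funext v
    simp only [aff, Prod.smul_fst, Prod.smul_snd, Pi.add_apply, Pi.smul_apply, smul_eq_mul,
      Fin.sum_univ_three, RingHom.id_apply]
    ring

lemma psi_inj (g : V3 → ZMod 2) (hg : wt g = 2) : Function.Injective (psi g) := by
  rw [← LinearMap.ker_eq_bot, LinearMap.ker_eq_bot']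
  rintro ⟨⟨a, b⟩, c⟩ h
  change aff a b + c • g = 0 at h
  have key : ∀ z : ZMod 2, z = 0 ∨ z = 1 := by decide
  rcases key c with rfl | rfl
  · rw [zero_smul, add_zero] at h
    obtain ⟨rfl, rfl⟩ := aff_zero a b h
    rfl
  · exfalso
    rw [one_smul] at h
    have : g = aff a b := by
      have h2 : aff a b + aff a b = 0 := by
        funext v; exact CharTwo.add_self_eq_zero (aff a b v)
      exact add_left_cancel (h.trans h2.symm)
    exact aff_wt a b (this ▸ hg)

lemma psi_rank (g : V3 → ZMod 2) (hg : wt g = 2) :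
    Module.finrank (ZMod 2) (LinearMap.range (psi g)) = 5 := by
  rw [LinearMap.finrank_range_of_inj (psi_inj g hg)]
  simp

lemma wt_psi_dec : (∀ t : (V3 × ZMod 2) × ZMod 2,
      wt (aff t.1.1 t.1.2 + t.2 • word 1 1 0 0 0 0 0 0) ∈ ({0, 2, 4, 6, 8} : Finset ℕ)) ∧
    (∀ w ∈ ({0, 2, 4, 6, 8} : Finset ℕ), ∃ t : (V3 × ZMod 2) × ZMod 2,
      wt (aff t.1.1 t.1.2 + t.2 • word 1 1 0 0 0 0 0 0) = w) := by
  decide +kernel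

lemma exists_code : SatCond 3 5 2 (LinearMap.range (psi (word 1 1 0 0 0 0 0 0))) := by
  refine ⟨psi_rank _ (by decide +kernel), by norm_num, by norm_num, ?_, ?_⟩
  · ext w
    have h8 : w ∈ ({0, 2 ^ 3 / 2 - 2, 2 ^ 3 / 2, 2 ^ 3 / 2 + 2, 2 ^ 3} : Set ℕ) ↔
        w ∈ ({0, 2, 4, 6, 8} : Finset ℕ) := by norm_num
    rw [h8]
    constructor
    · rintro ⟨_, ⟨t, rfl⟩, rfl⟩
      exact wt_psi_dec.1 t
    · intro hw
      obtain ⟨t, ht⟩ := wt_psi_dec.2 w hw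
      exact ⟨_, ⟨t, rfl⟩, ht⟩
  · rintro _ ⟨a, b, rfl⟩
    refine ⟨((a, b), 0), ?_⟩
    change aff a b + (0 : ZMod 2) • _ = _
    rw [zero_smul, add_zero]
    rfl

lemma a_eq_two {C : Submodule (ZMod 2) (V3 → ZMod 2)} {a : ℕ} (h : SatCond 3 5 a C) :
    a = 2 := by
  obtain ⟨-, h0, h4, hw, hR⟩ := h
  have hmem : ∀ x ∈ C, wt x ∈ ({0, 2 ^ 3 / 2 - a, 2 ^ 3 / 2, 2 ^ 3 / 2 + a, 2 ^ 3} : Set ℕ) := by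
    intro x hx
    rw [← hw]
    exact ⟨x, hx, rfl⟩
  have haff : ∀ c b, aff c b ∈ C := fun c b => hR ⟨c, b, rfl⟩
  obtain ⟨x, hx, hxw⟩ : (2 ^ 3 / 2 - a) ∈ {w : ℕ | ∃ x ∈ C, wt x = w} := by
    rw [hw]; simp
  have h4' : a < 4 := h4
  interval_cases a
  · obtain ⟨c, b, hcb⟩ := (wt_dec x).1 hxw
    have := hmem _ (C.add_mem hx (haff c b))
    rw [hcb] at this
    norm_num at this
  · rfl
  · obtain ⟨c, b, hcb⟩ := (wt_dec x).2 hxw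
    have := hmem _ (C.add_mem hx (haff c b))
    rw [hcb] at this
    norm_num at this

lemma weights {C : Submodule (ZMod 2) (V3 → ZMod 2)} {a : ℕ} (h : SatCond 3 5 a C) :
    {w : ℕ | ∃ x ∈ C, wt x = w} = ({0, 2, 4, 6, 8} : Set ℕ) := by
  obtain rfl := a_eq_two h
  rw [h.2.2.2.1]
  norm_num

lemma code_eq {C : Submodule (ZMod 2) (V3 → ZMod 2)} {a : ℕ} (h : SatCond 3 5 a C)
    {g : V3 → ZMod 2} (hg : g ∈ C) (hgw : wt g = 2) : LinearMap.range (psi g) = C := by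
  apply Submodule.eq_of_le_of_finrank_eq
  · rintro _ ⟨t, rfl⟩
    exact C.add_mem (h.2.2.2.2 ⟨t.1.1, t.1.2, rfl⟩) (C.smul_mem _ hg)
  · rw [psi_rank g hgw, h.1]

lemma wt_two {g : V3 → ZMod 2} (hg : wt g = 2) :
    ∃ p q : V3, p ≠ q ∧ ∀ v, g v = if v = p ∨ v = q then 1 else 0 := by
  obtain ⟨p, q, hpq, hs⟩ := Finset.card_eq_two.1 hg
  refine ⟨p, q, hpq, fun v => ?_⟩
  have hv : g v ≠ 0 ↔ v = p ∨ v = q := by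
    have : v ∈ (Finset.univ.filter fun i => g i ≠ 0) ↔ v ∈ ({p, q} : Finset V3) := by rw [hs]
    simpa using this
  have key : ∀ z : ZMod 2, z = 0 ∨ z = 1 := by decide
  split_ifs with h
  · exact (key (g v)).resolve_left (hv.2 h)
  · by_contra h'
    exact h (hv.1 h')

/-- The affine group is doubly transitive. -/
lemma exists_perm (p q p' q' : V3) (h : p ≠ q) (h' : p' ≠ q') :
    ∃ σ : Equiv.Perm V3, σ p' = p ∧ σ q' = q ∧
      ∀ a b, ∃ a' b', aff a b ∘ σ = aff a' b' := by
  have two : (2 : ZMod 2) = 0 := rfl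
  have key : ∀ z : ZMod 2, z = 0 ∨ z = 1 := by decide
  obtain ⟨c, hc, hc'⟩ := fun_dec (q - p) (q' - p') (sub_ne_zero.2 h.symm) (sub_ne_zero.2 h'.symm)
  let e : V3 := (q - p) - (q' - p')
  let L : V3 → V3 := fun v => v + (∑ i, c i * v i) • e
  have hce : ∑ i, c i * e i = 0 := by
    have : ∑ i, c i * e i = ∑ i, c i * (q - p) i - ∑ i, c i * (q' - p') i := by
      rw [← Finset.sum_sub_distrib]
      exact Finset.sum_congr rfl fun i _ => by simp only [e, Pi.sub_apply]; ring
    rw [this, hc, hc', sub_self]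
  have hL : Function.Involutive L := by
    intro v
    have h1 : ∑ i, c i * L v i = ∑ i, c i * v i := by
      have : ∑ i, c i * L v i = ∑ i, c i * v i + (∑ i, c i * v i) * ∑ i, c i * e i := by
        rw [Finset.mul_sum, ← Finset.sum_add_distrib]
        exact Finset.sum_congr rfl fun i _ => by
          simp only [L, Pi.add_apply, Pi.smul_apply, smul_eq_mul]; ring
      rw [this, hce, mul_zero, add_zero]
    change L v + (∑ i, c i * L v i) • e = v
    rw [h1]
    change v + _ + _ = v
    rw [add_assoc]
    have : (∑ i, c i * v i) • e + (∑ i, c i * v i) • e = 0 := by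
      funext i; exact CharTwo.add_self_eq_zero (((∑ i, c i * v i) • e) i)
    rw [this, add_zero]
  let σ : Equiv.Perm V3 := (Equiv.subRight p').trans (hL.toPerm.trans (Equiv.addRight p))
  have hσ : ∀ v, σ v = (v - p') + (∑ i, c i * (v - p') i) • e + p := fun v => rfl
  refine ⟨σ, ?_, ?_, ?_⟩
  · rw [hσ]; simp
  · rw [hσ, hc', one_smul]; simp only [e]; abel
  · intro a b
    refine ⟨a + (∑ i, a i * e i) • c,
      b + (∑ i, a i * (p - p') i) - (∑ i, a i * e i) * ∑ i, c i * p' i, ?_⟩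
    funext v
    simp only [Function.comp, hσ, aff, Fin.sum_univ_three, Pi.add_apply, Pi.sub_apply,
      Pi.smul_apply, smul_eq_mul]
    ring

lemma equiv_codes {C C' : Submodule (ZMod 2) (V3 → ZMod 2)} {a a' : ℕ}
    (h : SatCond 3 5 a C) (h' : SatCond 3 5 a' C') :
    CodeEquiv (↑C : Set (V3 → ZMod 2)) (↑C') := by
  obtain ⟨g, hg, hgw⟩ : (2 : ℕ) ∈ {w : ℕ | ∃ x ∈ C, wt x = w} := by rw [weights h]; simp
  obtain ⟨g', hg', hgw'⟩ : (2 : ℕ) ∈ {w : ℕ | ∃ x ∈ C', wt x = w} := by rw [weights h']; simp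
  obtain ⟨p, q, hpq, hgv⟩ := wt_two hgw
  obtain ⟨p', q', hpq', hgv'⟩ := wt_two hgw'
  obtain ⟨σ, hp, hq, hσ⟩ := exists_perm p q p' q' hpq hpq'
  have hgσ : g ∘ σ = g' := by
    funext v
    rw [Function.comp, hgv, hgv', ← hp, ← hq]
    simp only [σ.injective.eq_iff]
  refine ⟨σ, ?_⟩
  let E := LinearEquiv.funCongrLeft (ZMod 2) (ZMod 2) σ
  have hE : ∀ x, E x = x ∘ σ := fun x => rfl
  have hmap : C.map (E : (V3 → ZMod 2) →ₗ[ZMod 2] (V3 → ZMod 2)) = C' := by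
    apply Submodule.eq_of_le_of_finrank_eq
    · rintro _ ⟨x, hx, rfl⟩
      have hx' : x ∈ C := hx
      rw [← code_eq h hg hgw] at hx'
      obtain ⟨⟨⟨s, b⟩, c⟩, rfl⟩ := hx'
      obtain ⟨s', b', hs⟩ := hσ s b
      have : (psi g ((s, b), c)) ∘ σ = aff s' b' + c • g' := by
        rw [← hs, ← hgσ]; rfl
      change (psi g ((s, b), c)) ∘ σ ∈ C'
      rw [this]
      exact C'.add_mem (h'.2.2.2.2 ⟨s', b', rfl⟩) (C'.smul_mem _ hg')
    · rw [LinearEquiv.finrank_map_eq, h.1, h'.1]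
  rw [← hmap]
  rfl

/-- there is a binary `[8,5]` code satisfying (C1) and (C2), any
two such codes are equivalent, and the set of weights of any such code is
exactly `{0, 2, 4, 6, 8}` (i.e. `a = 2`). -/
theorem stmt7 :
    (∃ (C : Submodule (ZMod 2) ((Fin 3 → ZMod 2) → ZMod 2)) (a : ℕ), SatCond 3 5 a C) ∧
    (∀ (C C' : Submodule (ZMod 2) ((Fin 3 → ZMod 2) → ZMod 2)) (a a' : ℕ),
      SatCond 3 5 a C → SatCond 3 5 a' C' →
      CodeEquiv (↑C : Set ((Fin 3 → ZMod 2) → ZMod 2)) (↑C')) ∧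
    (∀ (C : Submodule (ZMod 2) ((Fin 3 → ZMod 2) → ZMod 2)) (a : ℕ),
      SatCond 3 5 a C →
      {w : ℕ | ∃ x ∈ C, wt x = w} = ({0, 2, 4, 6, 8} : Set ℕ)) :=
  ⟨⟨_, 2, exists_code⟩, fun _ _ _ _ h h' => equiv_codes h h', fun _ _ h => weights h⟩
end

section
/- The even weight [8,7] code, consisting of all vectors of F_2^8 of even weight, satisfies the conditions (C1) and (C2) (with m = 3, n = 8 and a = 2), and it is the unique binary [8,7] code satisfying the conditions (C1) and (C2). -/
open Finset

theorem wt_cast9 {ι : Type*} [Fintype ι] (x : ι → ZMod 2) :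
    ((wt x : ℕ) : ZMod 2) = ∑ i, x i := by
  have h2 : ∀ y : ZMod 2, (if y ≠ 0 then (1 : ZMod 2) else 0) = y := by decide
  unfold wt
  rw [Finset.card_filter]
  push_cast
  exact Finset.sum_congr rfl fun i _ => h2 (x i)

/-- The coordinate sum. -/
def sumMap9 : ((Fin 3 → ZMod 2) → ZMod 2) →ₗ[ZMod 2] ZMod 2 where
  toFun x := ∑ i, x i
  map_add' x y := by simp [Finset.sum_add_distrib]
  map_smul' c x := by simp [Finset.mul_sum]

theorem mem_ker9 (x : (Fin 3 → ZMod 2) → ZMod 2) :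
    x ∈ LinearMap.ker sumMap9 ↔ Even (wt x) := by
  rw [LinearMap.mem_ker, ← ZMod.natCast_eq_zero_iff_even, wt_cast9]
  rfl

theorem finrank_amb9 : Module.finrank (ZMod 2) ((Fin 3 → ZMod 2) → ZMod 2) = 8 := by
  simp

theorem finrank_ker9 : Module.finrank (ZMod 2) (LinearMap.ker sumMap9) = 7 := by
  have h := LinearMap.finrank_range_add_finrank_ker sumMap9
  have hs : LinearMap.range sumMap9 = ⊤ := by
    rw [LinearMap.range_eq_top]
    intro c
    refine ⟨Pi.single 0 c, ?_⟩
    change ∑ i, (Pi.single 0 c : (Fin 3 → ZMod 2) → ZMod 2) i = c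
    simp
  rw [hs, finrank_top, finrank_amb9, Module.finrank_self] at h
  omega

theorem wt_single_sub9 (i j : Fin 3 → ZMod 2) (hij : i ≠ j) :
    wt ((Pi.single i 1 : (Fin 3 → ZMod 2) → ZMod 2) - Pi.single j 1) = 2 := by
  unfold wt
  refine Eq.trans ?_ (Finset.card_pair hij)
  congr 1
  ext k
  simp only [Finset.mem_filter, Finset.mem_univ, true_and, Pi.sub_apply, Pi.single_apply,
    Finset.mem_insert, Finset.mem_singleton]
  by_cases h1 : k = i <;> by_cases h2 : k = j <;> simp_all

theorem exists_wt_two9 (C : Submodule (ZMod 2) ((Fin 3 → ZMod 2) → ZMod 2))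
    (hC : Module.finrank (ZMod 2) C = 7) : ∃ x ∈ C, wt x = 2 := by
  have hq := Submodule.finrank_quotient_add_finrank C
  rw [hC, finrank_amb9] at hq
  have hq1 : Module.finrank (ZMod 2) (((Fin 3 → ZMod 2) → ZMod 2) ⧸ C) = 1 := by omega
  have hcard := Module.natCard_eq_pow_finrank (K := ZMod 2)
    (V := ((Fin 3 → ZMod 2) → ZMod 2) ⧸ C)
  rw [hq1, Nat.card_zmod] at hcard
  have hni : ¬ Function.Injective
      (fun i : Fin 3 → ZMod 2 => C.mkQ (Pi.single i 1 : (Fin 3 → ZMod 2) → ZMod 2)) := by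
    intro hinj
    have hle := Nat.card_le_card_of_injective _ hinj
    rw [hcard] at hle
    simp at hle
  simp only [Function.Injective, not_forall] at hni
  obtain ⟨i, j, h, hij⟩ := hni
  refine ⟨_, (Submodule.Quotient.eq C).1 h, wt_single_sub9 i j hij⟩

theorem exists_wt9 (s : Finset (Fin 3 → ZMod 2)) :
    wt (fun i => if i ∈ s then (1 : ZMod 2) else 0) = s.card := by
  unfold wt
  congr 1
  ext k
  simp

theorem wt_le9 (x : (Fin 3 → ZMod 2) → ZMod 2) : wt x ≤ 8 := by
  have h := Finset.card_le_univ (Finset.univ.filter fun i => x i ≠ 0)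
  simpa [wt] using h

theorem rm_sum9 : ∀ (a : Fin 3 → ZMod 2) (b : ZMod 2),
    ∑ v : Fin 3 → ZMod 2, ((∑ i, a i * v i) + b) = 0 := by
  decide

/-- the even weight `[8,7]` code satisfies the conditions (C1) and
(C2) with `a = 2`, and it is the unique binary `[8,7]` code satisfying the
conditions. -/
theorem stmt9 :
    ∃ E : Submodule (ZMod 2) ((Fin 3 → ZMod 2) → ZMod 2),
      (↑E : Set ((Fin 3 → ZMod 2) → ZMod 2)) = {x | Even (wt x)} ∧
      SatCond 3 7 2 E ∧
      ∀ (C : Submodule (ZMod 2) ((Fin 3 → ZMod 2) → ZMod 2)) (a : ℕ),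
        SatCond 3 7 a C → C = E := by
  refine ⟨LinearMap.ker sumMap9, ?_, ⟨finrank_ker9, by norm_num, by norm_num, ?_, ?_⟩, ?_⟩
  · ext x
    exact mem_ker9 x
  · ext w
    simp only [Set.mem_setOf_eq, Set.mem_insert_iff, Set.mem_singleton_iff]
    constructor
    · rintro ⟨x, hx, rfl⟩
      obtain ⟨r, hr⟩ := (mem_ker9 x).1 hx
      have := wt_le9 x
      omega
    · intro hw
      have hw8 : w ≤ (Finset.univ : Finset (Fin 3 → ZMod 2)).card := by
        simp
        omega
      have hwe : Even w := by
        rcases hw with rfl | rfl | rfl | rfl | rfl <;> decide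
      obtain ⟨s, -, hs⟩ := Finset.exists_subset_card_eq hw8
      have h := exists_wt9 s
      rw [hs] at h
      exact ⟨_, (mem_ker9 _).2 (by rw [h]; exact hwe), h⟩
  · rintro f ⟨a, b, rfl⟩
    exact rm_sum9 a b
  · rintro C a ⟨hC, ha0, ha4, hw, -⟩
    have h2 : 2 ∈ {w : ℕ | ∃ x ∈ C, wt x = w} := exists_wt_two9 C hC
    rw [hw] at h2
    simp only [Set.mem_insert_iff, Set.mem_singleton_iff] at h2
    have ha : a = 2 := by omega
    subst ha
    apply Submodule.eq_of_le_of_finrank_eq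
    · intro x hx
      rw [mem_ker9]
      have h : wt x ∈ {w : ℕ | ∃ x ∈ C, wt x = w} := ⟨x, hx, rfl⟩
      rw [hw] at h
      simp only [Set.mem_insert_iff, Set.mem_singleton_iff] at h
      rw [Nat.even_iff]
      omega
    · rw [hC, finrank_ker9]
end

section
/- If there exists a binary [16,k] code satisfying the conditions (C1) and (C2) (with m = 4, n = 16) for some positive integer a, then k ∈ {6, 7, 8}. -/
open Finset

lemma aux_wt_add {ι : Type*} [Fintype ι] [DecidableEq ι] (x y : ι → ZMod 2) :
    wt (x + y) + 2 * wt (x * y) = wt x + wt y := by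
  have key : ∀ p q : ZMod 2, (if p + q ≠ 0 then 1 else 0) + 2 * (if p * q ≠ 0 then 1 else 0)
      = (if p ≠ 0 then 1 else 0) + (if q ≠ 0 then 1 else 0 : ℕ) := by decide
  simp only [wt, Finset.card_filter, Finset.mul_sum, ← Finset.sum_add_distrib, Pi.add_apply,
    Pi.mul_apply]
  exact Finset.sum_congr rfl fun i _ => key _ _

lemma aux_wt_cast {ι : Type*} [Fintype ι] (x : ι → ZMod 2) : (wt x : ZMod 2) = ∑ i, x i := by
  have key : ∀ p : ZMod 2, (if p ≠ 0 then 1 else 0 : ZMod 2) = p := by decide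
  simp only [wt, Finset.card_filter, Nat.cast_sum, Nat.cast_ite, Nat.cast_one, Nat.cast_zero]
  exact Finset.sum_congr rfl fun i _ => key _

lemma aux_wt_mul_le {ι : Type*} [Fintype ι] (x y : ι → ZMod 2) : wt (x * y) ≤ wt x := by
  apply Finset.card_le_card
  intro i
  simp only [Finset.mem_filter, Finset.mem_univ, true_and, Pi.mul_apply]
  exact fun h => left_ne_zero_of_mul h

/-- The linear map parametrizing `RM(1,4)`. -/
def auxRM : ((Fin 4 → ZMod 2) × ZMod 2) →ₗ[ZMod 2] ((Fin 4 → ZMod 2) → ZMod 2) where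
  toFun p := fun v => (∑ i, p.1 i * v i) + p.2
  map_add' p q := by
    funext v
    simp only [Prod.fst_add, Prod.snd_add, Pi.add_apply, add_mul, Finset.sum_add_distrib]
    ring
  map_smul' c p := by
    funext v
    simp [mul_add, Finset.mul_sum, mul_assoc]

lemma auxRM_wt (p : (Fin 4 → ZMod 2) × ZMod 2) :
    p = 0 ∨ wt (auxRM p) = 8 ∨ wt (auxRM p) = 16 := by
  have h : ∀ p : (Fin 4 → ZMod 2) × ZMod 2,
    p = 0 ∨ wt (fun v : Fin 4 → ZMod 2 => (∑ i, p.1 i * v i) + p.2) = 8 ∨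
      wt (fun v : Fin 4 → ZMod 2 => (∑ i, p.1 i * v i) + p.2) = 16 := by
    set_option maxRecDepth 100000 in
    decide +kernel
  exact h p

lemma aux_wt_zero {ι : Type*} [Fintype ι] : wt (0 : ι → ZMod 2) = 0 := by simp [wt]

lemma auxRM_inj : Function.Injective auxRM := by
  rw [injective_iff_map_eq_zero]
  intro p hp
  rcases auxRM_wt p with h | h | h
  · exact h
  · rw [hp, aux_wt_zero] at h; omega
  · rw [hp, aux_wt_zero] at h; omega

lemma auxRM_finrank : Module.finrank (ZMod 2) (LinearMap.range auxRM) = 5 := by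
  rw [LinearMap.finrank_range_of_inj auxRM_inj]
  simp

/-- Sphere packing bound. -/
lemma aux_sphere (C : Submodule (ZMod 2) ((Fin 4 → ZMod 2) → ZMod 2))
    (h : ∀ x ∈ C, x = 0 ∨ 5 ≤ wt x) : Module.finrank (ZMod 2) C ≤ 8 := by
  classical
  let V := (Fin 4 → ZMod 2)
  let S := {s : Finset V // s ∈ (Finset.univ : Finset V).powersetCard 1 ∪
    (Finset.univ : Finset V).powersetCard 2}
  let e : Finset V → (V → ZMod 2) := fun s v => if v ∈ s then 1 else 0
  have he : ∀ s, wt (e s) = s.card := by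
    intro s
    simp [wt, e]
  have hle : ∀ s : S, s.1.card ≤ 2 := by
    rintro ⟨s, hs⟩
    simp only [Finset.mem_union, Finset.mem_powersetCard] at hs
    simp only
    omega
  have hinj : Function.Injective (fun p : C × S => p.1.1 + e p.2.1) := by
    rintro ⟨c, s⟩ ⟨d, t⟩ hst
    simp only at hst
    have h1 : (c - d : C).1 = e s.1 + e t.1 := by
      have h2 : e t.1 + e t.1 = 0 := by
        funext v; exact CharTwo.add_self_eq_zero _
      have h3 : e s.1 - e t.1 = e s.1 + e t.1 := by
        rw [sub_eq_iff_eq_add, add_assoc, h2, add_zero]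
      have h4 : e s.1 + e s.1 = 0 := by
        funext v; exact CharTwo.add_self_eq_zero _
      calc (c - d : C).1 = c.1 - d.1 := rfl
        _ = (c.1 + e s.1) - d.1 - e s.1 := by abel
        _ = e t.1 - e s.1 := by rw [hst]; abel
        _ = e t.1 + e s.1 := by rw [sub_eq_iff_eq_add, add_assoc, h4, add_zero]
        _ = _ := add_comm _ _
    have hw : wt (c - d : C).1 ≤ 4 := by
      have := aux_wt_add (e s.1) (e t.1)
      rw [h1]
      rw [he, he] at this
      have := hle s
      have := hle t
      omega
    rcases h _ (c - d).2 with h0 | h0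
    · have hcd : c = d := sub_eq_zero.mp (Subtype.ext h0)
      subst hcd
      have hst' := add_left_cancel hst
      have : s.1 = t.1 := by
        ext v
        have := congrFun hst' v
        by_cases hs : v ∈ s.1 <;> by_cases ht : v ∈ t.1 <;> simp_all [e]
      rw [Subtype.ext this]
    · omega
  have hcard := Fintype.card_le_of_injective _ hinj
  have hV : Fintype.card V = 16 := by simp [V]
  have hS : Fintype.card S = 136 := by
    rw [Fintype.card_coe, Finset.card_union_of_disjoint, Finset.card_powersetCard,
      Finset.card_powersetCard, Finset.card_univ, hV]
    · decide
    · rw [Finset.disjoint_left]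
      intro s
      simp only [Finset.mem_powersetCard]
      omega
  rw [Fintype.card_prod, hS, Module.card_eq_pow_finrank (K := ZMod 2) (V := C),
    Fintype.card_fun, hV, ZMod.card] at hcard
  by_contra hk
  have : 2 ^ 9 ≤ 2 ^ Module.finrank (ZMod 2) C := Nat.pow_le_pow_right (by norm_num) (by omega)
  omega

/-- Self-orthogonal codes of length 16 have dimension at most 8. -/
lemma aux_selforth (C : Submodule (ZMod 2) ((Fin 4 → ZMod 2) → ZMod 2))
    (h : ∀ x ∈ C, 4 ∣ wt x) : Module.finrank (ZMod 2) C ≤ 8 := by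
  let B := dotProductBilin (m := Fin 4 → ZMod 2) (R := ZMod 2) (S := ZMod 2) (A := ZMod 2)
  have horth : ∀ x ∈ C, ∀ y ∈ C, x ⬝ᵥ y = 0 := by
    intro x hx y hy
    have h1 := aux_wt_add x y
    have h2 := h x hx
    have h3 := h y hy
    have h4 := h _ (C.add_mem hx hy)
    have h5 : 2 ∣ wt (x * y) := by omega
    have h6 := (ZMod.natCast_eq_zero_iff (wt (x * y)) 2).2 h5
    rw [aux_wt_cast] at h6
    exact h6
  let f : ((Fin 4 → ZMod 2) → ZMod 2) →ₗ[ZMod 2] Module.Dual (ZMod 2) ((Fin 4 → ZMod 2) → ZMod 2) := B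
  have hf : Function.Injective f := by
    rw [injective_iff_map_eq_zero]
    intro x hx
    funext v
    have := LinearMap.congr_fun hx (Pi.single v 1)
    simpa [f, B] using this
  have hle : C.map f ≤ C.dualAnnihilator := by
    rintro _ ⟨x, hx, rfl⟩
    rw [Submodule.mem_dualAnnihilator]
    intro y hy
    exact horth x hx y hy
  have h1 := Submodule.finrank_mono hle
  rw [← (Submodule.equivMapOfInjective f hf C).finrank_eq] at h1
  have h2 := Subspace.finrank_add_finrank_dualAnnihilator_eq C
  have h3 : Module.finrank (ZMod 2) ((Fin 4 → ZMod 2) → ZMod 2) = 16 := by simp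
  omega

/-- if there exists a binary `[16,k]` code satisfying (C1) and
(C2), then `k ∈ {6, 7, 8}`. -/
theorem stmt10 (k a : ℕ)
    (C : Submodule (ZMod 2) ((Fin 4 → ZMod 2) → ZMod 2))
    (hC : SatCond 4 k a C) :
    k ∈ ({6, 7, 8} : Set ℕ) := by
  obtain ⟨hk, ha, ha', hw, hRM⟩ := hC
  norm_num at ha' hw
  have hle : LinearMap.range auxRM ≤ C := by
    rintro _ ⟨p, rfl⟩
    exact hRM ⟨p.1, p.2, rfl⟩
  have hwt : ∀ x ∈ C, wt x = 0 ∨ wt x = 8 - a ∨ wt x = 8 ∨ wt x = 8 + a ∨ wt x = 16 := by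
    intro x hx
    have : wt x ∈ {w : ℕ | ∃ x ∈ C, wt x = w} := ⟨x, hx, rfl⟩
    rw [hw] at this
    simpa using this
  obtain ⟨x, hxC, hx⟩ : (8 - a) ∈ {w : ℕ | ∃ x ∈ C, wt x = w} := by
    rw [hw]; simp
  have hlt : LinearMap.range auxRM < C := by
    refine lt_of_le_of_ne hle ?_
    rintro heq
    rw [← heq] at hxC
    obtain ⟨p, rfl⟩ := hxC
    rcases auxRM_wt p with h | h | h
    · rw [h, map_zero, aux_wt_zero] at hx; omega
    · omega
    · omega
  have h5 := Submodule.finrank_lt_finrank_of_lt hlt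
  rw [auxRM_finrank] at h5
  have h8 : Module.finrank (ZMod 2) C ≤ 8 := by
    by_cases h3 : a ≤ 3
    · apply aux_sphere
      intro y hy
      by_cases h0 : wt y = 0
      · left
        funext i
        simp only [wt, Finset.card_eq_zero] at h0
        by_contra hi
        have : i ∈ (Finset.univ.filter fun i => y i ≠ 0) := by simpa using hi
        rw [h0] at this
        simp at this
      · right
        have := hwt y hy
        omega
    by_cases h4 : a = 4
    · subst h4
      apply aux_selforth
      intro y hy
      have := hwt y hy
      omega
    exfalso
    have hl : ∀ p : (Fin 4 → ZMod 2) × ZMod 2, wt (auxRM p) = 8 →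
        a = 6 ∧ wt (x * auxRM p) = 1 := by
      intro p hp
      have h1 := aux_wt_add x (auxRM p)
      have h2 := aux_wt_mul_le x (auxRM p)
      have h3 := hwt _ (C.add_mem hxC (hle ⟨p, rfl⟩))
      omega
    have hone : ∀ p : (Fin 4 → ZMod 2) × ZMod 2, wt (auxRM p) = 8 →
        ∑ v, (x * auxRM p) v = 1 := by
      intro p hp
      rw [← aux_wt_cast, (hl p hp).2, Nat.cast_one]
    have e1 := hone (![1,0,0,0], 0) (by decide +kernel)
    have e2 := hone (![0,1,0,0], 0) (by decide +kernel)
    have e3 := hone (![1,0,0,0] + ![0,1,0,0], 0 + 0) (by decide +kernel)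
    rw [← Prod.mk_add_mk, map_add, mul_add] at e3
    simp only [Pi.add_apply, Finset.sum_add_distrib] at e3
    rw [e1, e2] at e3
    exact absurd e3 (by decide)
  rw [hk] at h5 h8
  have : k = 6 ∨ k = 7 ∨ k = 8 := by omega
  simpa using this
end

section
/- There exist exactly two equivalence classes of binary [16,6] codes satisfying the conditions (C1) and (C2) (with m = 4, n = 16): there are two inequivalent [16,6] codes satisfying the conditions, one of minimum weight 6 and one of minimum weight 4, and every [16,6] code satisfying the conditions is equivalent to one of them. -/
open Finset

/-- Index of a point of `F_2^4` in `0..15`. -/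
def ptIdx (v : Fin 4 → ZMod 2) : ℕ :=
  (v 0).val + 2 * (v 1).val + 4 * (v 2).val + 8 * (v 3).val

/-- The Boolean function whose truth table is the binary expansion of `n`. -/
def tabF (n : ℕ) (v : Fin 4 → ZMod 2) : ZMod 2 := if n.testBit (ptIdx v) then 1 else 0

/-- Affine functions. -/
def affMap : ((Fin 4 → ZMod 2) × ZMod 2) →ₗ[ZMod 2] ((Fin 4 → ZMod 2) → ZMod 2) where
  toFun p := fun v => (∑ i, p.1 i * v i) + p.2
  map_add' p q := by
    ext v
    simp only [Prod.fst_add, Prod.snd_add, Pi.add_apply, add_mul, Finset.sum_add_distrib]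
    ring
  map_smul' c p := by
    ext v
    simp only [Prod.smul_fst, Prod.smul_snd, Pi.smul_apply, smul_eq_mul, mul_assoc,
      ← Finset.mul_sum, RingHom.id_apply, mul_add]

lemma affMap_apply (p : (Fin 4 → ZMod 2) × ZMod 2) (v : Fin 4 → ZMod 2) :
    affMap p v = (∑ i, p.1 i * v i) + p.2 := rfl

lemma affMap_inj : Function.Injective affMap := by
  rw [← LinearMap.ker_eq_bot, LinearMap.ker_eq_bot']
  rintro ⟨a, b⟩ h
  have hb : b = 0 := by
    have := congrFun h 0
    simpa [affMap_apply] using this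
  subst hb
  have ha : a = 0 := by
    ext i
    have := congrFun h (Pi.single i 1)
    simpa [affMap_apply, Pi.single_apply] using this
  rw [ha]; rfl

lemma mem_RM1_iff (x : (Fin 4 → ZMod 2) → ZMod 2) :
    x ∈ RM1 4 ↔ x ∈ LinearMap.range affMap := by
  constructor
  · rintro ⟨a, b, rfl⟩
    exact ⟨(a, b), rfl⟩
  · rintro ⟨⟨a, b⟩, rfl⟩
    exact ⟨a, b, rfl⟩

lemma finrank_affRange : Module.finrank (ZMod 2) (LinearMap.range affMap) = 5 := by
  rw [LinearMap.finrank_range_of_inj affMap_inj]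
  simp

/-- The code `RM(1,4) + ⟨f⟩`. -/
def codeOf (f : (Fin 4 → ZMod 2) → ZMod 2) :
    Submodule (ZMod 2) ((Fin 4 → ZMod 2) → ZMod 2) :=
  LinearMap.range affMap ⊔ Submodule.span (ZMod 2) {f}

lemma zmod2_cases : ∀ c : ZMod 2, c = 0 ∨ c = 1 := by decide

lemma mem_codeOf (f x : (Fin 4 → ZMod 2) → ZMod 2) :
    x ∈ codeOf f ↔ ∃ p, x = affMap p ∨ x = affMap p + f := by
  unfold codeOf
  rw [Submodule.mem_sup]
  constructor
  · rintro ⟨_, ⟨p, rfl⟩, z, hz, rfl⟩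
    obtain ⟨c, rfl⟩ := Submodule.mem_span_singleton.1 hz
    refine ⟨p, ?_⟩
    rcases zmod2_cases c with rfl | rfl
    · left; simp
    · right; simp
  · rintro ⟨p, rfl | rfl⟩
    · exact ⟨_, ⟨p, rfl⟩, 0, Submodule.zero_mem _, by simp⟩
    · exact ⟨_, ⟨p, rfl⟩, f, Submodule.mem_span_singleton_self f, rfl⟩

lemma finrank_codeOf (f : (Fin 4 → ZMod 2) → ZMod 2) (hf : f ∉ LinearMap.range affMap) :
    Module.finrank (ZMod 2) (codeOf f) = 6 := by
  have h1 : LinearMap.range affMap < codeOf f := by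
    refine lt_of_le_of_ne le_sup_left ?_
    intro h
    apply hf
    rw [h]
    exact (le_sup_right : _ ≤ codeOf f) (Submodule.mem_span_singleton_self f)
  have h2 := Submodule.finrank_lt_finrank_of_lt h1
  have h3 := Submodule.finrank_add_le_finrank_add_finrank (LinearMap.range affMap)
    (Submodule.span (ZMod 2) {f})
  have h4 := finrank_span_le_card (R := ZMod 2) ({f} : Set ((Fin 4 → ZMod 2) → ZMod 2))
  rw [finrank_affRange] at h2 h3
  simp only [Set.toFinset_singleton, Finset.card_singleton] at h4
  unfold codeOf at h2 ⊢
  omega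

lemma eq_codeOf (C : Submodule (ZMod 2) ((Fin 4 → ZMod 2) → ZMod 2))
    (hC : Module.finrank (ZMod 2) C = 6) (hR : LinearMap.range affMap ≤ C)
    (f : (Fin 4 → ZMod 2) → ZMod 2) (hfC : f ∈ C) (hf : f ∉ LinearMap.range affMap) :
    C = codeOf f := by
  symm
  apply Submodule.eq_of_le_of_finrank_le
  · exact sup_le hR (by simpa [Submodule.span_le] using hfC)
  · rw [finrank_codeOf f hf, hC]

lemma codeEquiv_of (f g : (Fin 4 → ZMod 2) → ZMod 2) (σ : Equiv.Perm (Fin 4 → ZMod 2))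
    (h1 : ∀ x ∈ LinearMap.range affMap, x ∘ σ ∈ LinearMap.range affMap)
    (h2 : ∀ x ∈ LinearMap.range affMap, x ∘ σ.symm ∈ LinearMap.range affMap)
    (r : (Fin 4 → ZMod 2) → ZMod 2) (hr : r ∈ LinearMap.range affMap)
    (hfg : f ∘ σ = r + g) :
    CodeEquiv (codeOf f : Set ((Fin 4 → ZMod 2) → ZMod 2)) (codeOf g) := by
  have mem : ∀ f x, x ∈ codeOf f ↔ ∃ y ∈ LinearMap.range affMap, x = y ∨ x = y + f := by
    intro f x
    rw [mem_codeOf]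
    constructor
    · rintro ⟨p, h⟩
      exact ⟨_, ⟨p, rfl⟩, h⟩
    · rintro ⟨_, ⟨p, rfl⟩, h⟩
      exact ⟨p, h⟩
  refine ⟨σ, ?_⟩
  ext x
  simp only [SetLike.mem_coe, Set.mem_image, mem]
  constructor
  · rintro ⟨y, hy, rfl | rfl⟩
    · refine ⟨_, ⟨_, h2 _ hy, Or.inl rfl⟩, ?_⟩
      ext v
      simp
    · refine ⟨_, ⟨_, h2 _ (Submodule.sub_mem _ hy hr), Or.inr rfl⟩, ?_⟩
      ext v
      have e := congrFun hfg v
      simp only [Function.comp_apply, Pi.add_apply] at e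
      simp only [Function.comp_apply, Pi.add_apply, Pi.sub_apply, Equiv.symm_apply_apply, e]
      ring
  · rintro ⟨_, ⟨y, hy, rfl | rfl⟩, rfl⟩
    · exact ⟨_, h1 _ hy, Or.inl rfl⟩
    · refine ⟨_, Submodule.add_mem _ (h1 _ hy) hr, Or.inr ?_⟩
      rw [add_assoc, ← hfg]
      rfl

/-- Truth tables of the 32 affine functions. -/
def affTab : List ℕ :=
  [0, 43690, 52428, 26214, 61680, 23130, 15420, 38550, 65280, 21930, 13260, 39270, 4080, 42330,
   49980, 27030, 65535, 21845, 13107, 39321, 3855, 42405, 50115, 26985, 255, 43605, 52275, 26265,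
   61455, 23205, 15555, 38505]

/-- Rows `(n, l, k, t, g)`: the linear map with coordinate functions `l` has inverse `k` and
carries `n` to `t + g`, where `t` is affine. -/
def quadTab : List (ℕ × (ℕ × ℕ × ℕ × ℕ) × (ℕ × ℕ × ℕ × ℕ) × ℕ × ℕ) :=
  [(1632, (15420, 38550, 13260, 65280), (26214, 4080, 42330, 65280), 0, 34952),
   (2720, (43690, 21930, 61680, 15420), (43690, 4080, 61680, 26214), 0, 34952),
   (3264, (38550, 52428, 65280, 39270), (49980, 52428, 42330, 61680), 52428, 34952),
   (4680, (4080, 21930, 49980, 13260), (27030, 23130, 4080, 42330), 52428, 34952),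
   (5160, (38550, 4080, 42330, 23130), (15420, 21930, 49980, 4080), 0, 34952),
   (6376, (38550, 4080, 42330, 23130), (15420, 21930, 49980, 4080), 65280, 30856),
   (7816, (27030, 61680, 65280, 15420), (42330, 13260, 52428, 61680), 15420, 30856),
   (8840, (52428, 38550, 4080, 61680), (39270, 43690, 65280, 4080), 52428, 34952),
   (9448, (27030, 26214, 61680, 49980), (21930, 39270, 61680, 38550), 23130, 30856),
   (10280, (43690, 27030, 4080, 39270), (43690, 38550, 13260, 49980), 43690, 34952),
   (11848, (61680, 43690, 27030, 65280), (52428, 27030, 43690, 65280), 43690, 30856),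
   (12480, (15420, 42330, 43690, 27030), (61680, 13260, 39270, 42330), 0, 34952),
   (13984, (61680, 65280, 42330, 15420), (38550, 21930, 43690, 52428), 61680, 30856),
   (14944, (43690, 38550, 65280, 52428), (43690, 65280, 39270, 61680), 0, 30856),
   (15360, (49980, 38550, 61680, 43690), (65280, 49980, 61680, 39270), 43690, 34952),
   (17128, (21930, 27030, 43690, 52428), (61680, 65280, 39270, 23130), 21930, 30856),
   (17544, (21930, 26214, 49980, 65280), (21930, 39270, 38550, 65280), 43690, 34952),
   (18504, (49980, 26214, 27030, 39270), (23130, 38550, 4080, 13260), 43690, 34952),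
   (20008, (61680, 43690, 13260, 15420), (52428, 21930, 43690, 42330), 61680, 30856),
   (20640, (65280, 38550, 26214, 13260), (42330, 21930, 15420, 43690), 52428, 34952),
   (22208, (26214, 13260, 43690, 42330), (61680, 23130, 39270, 38550), 65280, 30856),
   (23040, (15420, 49980, 23130, 43690), (65280, 42330, 4080, 26214), 43690, 34952),
   (23648, (15420, 49980, 23130, 43690), (65280, 42330, 4080, 26214), 43690, 30856),
   (24672, (38550, 23130, 26214, 42330), (38550, 26214, 23130, 13260), 52428, 34952),
   (26112, (13260, 39270, 61680, 26214), (26214, 39270, 61680, 13260), 43690, 34952),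
   (27328, (43690, 21930, 61680, 15420), (43690, 4080, 61680, 26214), 0, 30856),
   (27808, (61680, 52428, 65280, 26214), (13260, 52428, 43690, 61680), 52428, 30856),
   (29224, (38550, 23130, 26214, 42330), (38550, 26214, 23130, 13260), 52428, 30856),
   (29768, (26214, 15420, 21930, 52428), (21930, 65280, 13260, 42330), 0, 30856),
   (30856, (65280, 38550, 26214, 13260), (42330, 21930, 15420, 43690), 52428, 30856),
   (32488, (27030, 38550, 52428, 43690), (65280, 61680, 49980, 26214), 38550, 30856),
   (33320, (26214, 23130, 4080, 39270), (27030, 49980, 42330, 21930), 52428, 34952),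
   (33864, (49980, 52428, 13260, 38550), (27030, 52428, 23130, 15420), 52428, 34952),
   (34952, (52428, 26214, 4080, 23130), (26214, 43690, 39270, 27030), 52428, 34952),
   (36584, (61680, 15420, 13260, 27030), (42330, 26214, 43690, 38550), 61680, 34952),
   (36960, (15420, 27030, 52428, 65280), (39270, 61680, 23130, 65280), 0, 34952),
   (38400, (4080, 15420, 39270, 26214), (38550, 27030, 42330, 4080), 43690, 34952),
   (39616, (26214, 21930, 61680, 15420), (42330, 4080, 61680, 27030), 15420, 30856),
   (40096, (4080, 15420, 39270, 26214), (38550, 27030, 42330, 4080), 21930, 30856),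
   (41120, (26214, 13260, 43690, 42330), (61680, 23130, 39270, 38550), 43690, 34952),
   (42688, (23130, 13260, 21930, 38550), (27030, 21930, 49980, 39270), 27030, 30856),
   (43520, (43690, 38550, 65280, 52428), (43690, 65280, 39270, 61680), 0, 34952),
   (44128, (4080, 43690, 65280, 13260), (52428, 4080, 23130, 61680), 65280, 30856),
   (45800, (4080, 15420, 27030, 65280), (49980, 39270, 21930, 65280), 49980, 34952),
   (46216, (4080, 21930, 65280, 27030), (15420, 27030, 23130, 61680), 21930, 30856),
   (47176, (49980, 61680, 38550, 43690), (65280, 49980, 52428, 42330), 43690, 30856),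
   (48680, (13260, 42330, 15420, 65280), (38550, 21930, 42330, 65280), 13260, 34952),
   (49344, (13260, 26214, 52428, 38550), (15420, 61680, 13260, 23130), 52428, 34952),
   (50848, (43690, 21930, 13260, 42330), (43690, 38550, 13260, 26214), 65280, 30856),
   (51808, (27030, 26214, 23130, 43690), (65280, 13260, 4080, 27030), 23130, 30856),
   (52224, (61680, 52428, 65280, 26214), (13260, 52428, 43690, 61680), 52428, 34952),
   (53896, (26214, 23130, 4080, 39270), (27030, 49980, 42330, 21930), 13260, 30856),
   (54504, (27030, 39270, 65280, 23130), (39270, 42330, 26214, 61680), 13260, 34952),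
   (55336, (4080, 23130, 43690, 52428), (61680, 65280, 15420, 38550), 61680, 30856),
   (56904, (21930, 38550, 27030, 61680), (38550, 42330, 65280, 15420), 15420, 34952),
   (57928, (21930, 38550, 27030, 61680), (38550, 42330, 65280, 15420), 15420, 30856),
   (58408, (15420, 42330, 43690, 27030), (61680, 13260, 39270, 42330), 21930, 30856),
   (59624, (13260, 39270, 21930, 23130), (26214, 15420, 39270, 38550), 39270, 34952),
   (61064, (15420, 23130, 21930, 61680), (13260, 21930, 65280, 49980), 61680, 34952),
   (61440, (27030, 38550, 52428, 43690), (65280, 61680, 49980, 26214), 0, 34952),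
   (63072, (13260, 38550, 49980, 27030), (4080, 39270, 23130, 13260), 27030, 34952),
   (64160, (4080, 38550, 27030, 49980), (4080, 21930, 38550, 15420), 49980, 34952),
   (64704, (4080, 39270, 21930, 13260), (13260, 15420, 27030, 49980), 39270, 34952)]

/-- Number of ones among the 16 low bits. -/
def popc (n : ℕ) : ℕ :=
  Nat.add (Nat.add (Nat.add (Nat.add (Nat.add (Nat.add (Nat.add (Nat.add (Nat.add (Nat.add (Nat.add (Nat.add (Nat.add (Nat.add (Nat.add (Nat.mod n 2)
  (Nat.mod (Nat.div n 2) 2))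
  (Nat.mod (Nat.div n 4) 2))
  (Nat.mod (Nat.div n 8) 2))
  (Nat.mod (Nat.div n 16) 2))
  (Nat.mod (Nat.div n 32) 2))
  (Nat.mod (Nat.div n 64) 2))
  (Nat.mod (Nat.div n 128) 2))
  (Nat.mod (Nat.div n 256) 2))
  (Nat.mod (Nat.div n 512) 2))
  (Nat.mod (Nat.div n 1024) 2))
  (Nat.mod (Nat.div n 2048) 2))
  (Nat.mod (Nat.div n 4096) 2))
  (Nat.mod (Nat.div n 8192) 2))
  (Nat.mod (Nat.div n 16384) 2))
  (Nat.mod (Nat.div n 32768) 2)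

lemma popc_eq (n : ℕ) : popc n =
  n % 2 + n / 2 % 2 + n / 4 % 2 + n / 8 % 2 + n / 16 % 2 + n / 32 % 2 + n / 64 % 2 +
    n / 128 % 2 + n / 256 % 2 + n / 512 % 2 + n / 1024 % 2 + n / 2048 % 2 + n / 4096 % 2 +
    n / 8192 % 2 + n / 16384 % 2 + n / 32768 % 2 := rfl

/-- The weight condition on the coset of the function with table `n`. -/
def goodTab (n a : ℕ) : Bool :=
  affTab.all fun t => Nat.beq (Nat.mod (Nat.div
    (Nat.add (Nat.add (Nat.pow 2 (Nat.sub 8 a)) 256) (Nat.pow 2 (Nat.add 8 a)))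
    (Nat.pow 2 (popc (Nat.xor n t)))) 2) 1

/-- Search over normalized tables. -/
def searchOK : Bool :=
  (List.range 2).all fun x => (List.range 8).all fun y => (List.range 128).all fun z =>
    [1, 2, 3, 4, 5, 6, 7].all fun a =>
      !(goodTab (8 * x + 32 * y + 512 * z) a) ||
        quadTab.any fun r => Nat.beq r.1 (8 * x + 32 * y + 512 * z)

set_option maxRecDepth 100000 in
lemma searchOK_true : searchOK = true := by decide +kernel

lemma forall_vec (P : (Fin 4 → ZMod 2) → Prop)
    (h : ∀ a b c d : ZMod 2, P ![a, b, c, d]) (v : Fin 4 → ZMod 2) : P v := by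
  have : v = ![v 0, v 1, v 2, v 3] := by
    ext i; fin_cases i <;> rfl
  rw [this]; exact h _ _ _ _

lemma tabF_xor (n t : ℕ) : tabF (n ^^^ t) = tabF n + tabF t := by
  ext v
  simp only [tabF, Nat.testBit_xor, Pi.add_apply]
  cases n.testBit (ptIdx v) <;> cases t.testBit (ptIdx v) <;> decide

lemma tabF_smul (c : ZMod 2) (m : ℕ) (v : Fin 4 → ZMod 2) :
    tabF (if c = 0 then 0 else m) v = c * tabF m v := by
  rcases zmod2_cases c with rfl | rfl
  · simp [tabF]
  · simp

/-- Table of the affine function with given coefficients. -/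
def affN (a b c d e : ZMod 2) : ℕ :=
  (if a = 0 then 0 else 43690) ^^^ (if b = 0 then 0 else 52428) ^^^ (if c = 0 then 0 else 61680) ^^^
    (if d = 0 then 0 else 65280) ^^^ (if e = 0 then 0 else 65535)

lemma basis_tab : ∀ v : Fin 4 → ZMod 2, tabF 43690 v = v 0 ∧ tabF 52428 v = v 1 ∧
    tabF 61680 v = v 2 ∧ tabF 65280 v = v 3 ∧ tabF 65535 v = 1 :=
  forall_vec _ (by decide +kernel)

lemma affMap_eq_tabF (p : (Fin 4 → ZMod 2) × ZMod 2) :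
    affMap p = tabF (affN (p.1 0) (p.1 1) (p.1 2) (p.1 3) p.2) := by
  ext v
  obtain ⟨h0, h1, h2, h3, h4⟩ := basis_tab v
  simp only [affN, tabF_xor, Pi.add_apply, tabF_smul, h0, h1, h2, h3, h4, affMap_apply,
    Fin.sum_univ_four, mul_one]

lemma affN_mem : ∀ a b c d e : ZMod 2, affN a b c d e ∈ affTab := by decide +kernel

lemma affTab_affN : ∀ t ∈ affTab, ∃ a b c d e : ZMod 2, t = affN a b c d e := by decide +kernel

lemma affTab_mem (t : ℕ) (ht : t ∈ affTab) : tabF t ∈ LinearMap.range affMap := by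
  obtain ⟨a, b, c, d, e, rfl⟩ := affTab_affN t ht
  exact ⟨(![a, b, c, d], e), affMap_eq_tabF _⟩

lemma affMap_tab (p : (Fin 4 → ZMod 2) × ZMod 2) : ∃ t ∈ affTab, affMap p = tabF t :=
  ⟨_, affN_mem _ _ _ _ _, affMap_eq_tabF p⟩

/-- The map of `F_2^4` with given coordinate functions. -/
def linMap (l : ℕ × ℕ × ℕ × ℕ) (v : Fin 4 → ZMod 2) : Fin 4 → ZMod 2 :=
  ![tabF l.1 v, tabF l.2.1 v, tabF l.2.2.1 v, tabF l.2.2.2 v]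

/-- The same map on indices. -/
def linIdx (l : ℕ × ℕ × ℕ × ℕ) (w : ℕ) : ℕ :=
  (l.1.testBit w).toNat + 2 * (l.2.1.testBit w).toNat + 4 * (l.2.2.1.testBit w).toNat +
    8 * (l.2.2.2.testBit w).toNat

lemma ptIdx_linMap (l : ℕ × ℕ × ℕ × ℕ) (v : Fin 4 → ZMod 2) :
    ptIdx (linMap l v) = linIdx l (ptIdx v) := by
  have key : ∀ m : ℕ, (tabF m v).val = (m.testBit (ptIdx v)).toNat := by
    intro m
    unfold tabF
    cases m.testBit (ptIdx v) <;> rfl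
  have e : ∀ a b c d : ZMod 2, ptIdx ![a, b, c, d] =
    a.val + 2 * b.val + 4 * c.val + 8 * d.val := fun _ _ _ _ => rfl
  rw [linMap, e, key, key, key, key, linIdx]

lemma ptIdx_lt : ∀ v, ptIdx v < 16 := forall_vec _ (by decide)

lemma ptIdx_inv : ∀ v : Fin 4 → ZMod 2, v = ![(ptIdx v : ZMod 2), (ptIdx v / 2 : ℕ),
      (ptIdx v / 4 : ℕ), (ptIdx v / 8 : ℕ)] := forall_vec _ (by decide)

lemma ptIdx_inj {u v : Fin 4 → ZMod 2} (h : ptIdx u = ptIdx v) : u = v := by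
  rw [ptIdx_inv u, ptIdx_inv v, h]

lemma linMap_aff (l : ℕ × ℕ × ℕ × ℕ)
    (hl : l.1 ∈ affTab ∧ l.2.1 ∈ affTab ∧ l.2.2.1 ∈ affTab ∧ l.2.2.2 ∈ affTab) :
    ∀ x ∈ LinearMap.range affMap, x ∘ linMap l ∈ LinearMap.range affMap := by
  rintro _ ⟨p, rfl⟩
  obtain ⟨h0, h1, h2, h3⟩ := hl
  have hb : (fun _ => p.2) ∈ LinearMap.range affMap :=
    ⟨(0, p.2), by ext v; simp [affMap_apply]⟩
  have e : affMap p ∘ linMap l = p.1 0 • tabF l.1 + p.1 1 • tabF l.2.1 + p.1 2 • tabF l.2.2.1 +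
      p.1 3 • tabF l.2.2.2 + fun _ => p.2 := by
    ext v
    simp [affMap_apply, Fin.sum_univ_four, linMap]
  rw [e]
  exact Submodule.add_mem _ (Submodule.add_mem _ (Submodule.add_mem _ (Submodule.add_mem _
    (Submodule.smul_mem _ _ (affTab_mem _ h0)) (Submodule.smul_mem _ _ (affTab_mem _ h1)))
    (Submodule.smul_mem _ _ (affTab_mem _ h2))) (Submodule.smul_mem _ _ (affTab_mem _ h3))) hb

set_option maxRecDepth 100000 in
lemma quadTab_spec : ∀ r ∈ quadTab, ∀ w < 16,
    linIdx r.2.2.1 (linIdx r.2.1 w) = w ∧ linIdx r.2.1 (linIdx r.2.2.1 w) = w ∧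
    r.1.testBit (linIdx r.2.1 w) = (r.2.2.2.1 ^^^ r.2.2.2.2).testBit w := by
  decide +kernel

lemma quadTab_aff : ∀ r ∈ quadTab,
    (r.2.1.1 ∈ affTab ∧ r.2.1.2.1 ∈ affTab ∧ r.2.1.2.2.1 ∈ affTab ∧ r.2.1.2.2.2 ∈ affTab) ∧
    (r.2.2.1.1 ∈ affTab ∧ r.2.2.1.2.1 ∈ affTab ∧ r.2.2.1.2.2.1 ∈ affTab ∧
      r.2.2.1.2.2.2 ∈ affTab) ∧
    r.2.2.2.1 ∈ affTab ∧ (r.2.2.2.2 = 30856 ∨ r.2.2.2.2 = 34952) := by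
  decide +kernel

/-- Points of `F_2^4` numbered. -/
def ptEquiv : (ZMod 2 × ZMod 2) × (ZMod 2 × ZMod 2) ≃ (Fin 4 → ZMod 2) where
  toFun q := ![q.1.1, q.1.2, q.2.1, q.2.2]
  invFun v := ((v 0, v 1), (v 2, v 3))
  left_inv q := rfl
  right_inv v := by ext i; fin_cases i <;> rfl

lemma wt_eq_sum (x : (Fin 4 → ZMod 2) → ZMod 2) :
    wt x = ∑ a : ZMod 2, ∑ b : ZMod 2, ∑ c : ZMod 2, ∑ d : ZMod 2,
      if x ![a, b, c, d] ≠ 0 then 1 else 0 := by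
  unfold wt
  rw [Finset.card_filter, ← ptEquiv.sum_comp]
  simp only [Fintype.sum_prod_type]
  rfl

lemma sum_zmod2 (f : ZMod 2 → ℕ) : ∑ a, f a = f 0 + f 1 := Fin.sum_univ_two f

lemma wt_tabF (n : ℕ) : wt (tabF n) = popc n := by
  have key : ∀ v, (if tabF n v ≠ 0 then 1 else 0) = n / 2 ^ (ptIdx v) % 2 := by
    intro v
    simp only [tabF, Nat.testBit_eq_decide_div_mod_eq]
    rcases Nat.mod_two_eq_zero_or_one (n / 2 ^ ptIdx v) with h | h <;> simp [h]
  rw [wt_eq_sum]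
  simp only [key]
  simp only [sum_zmod2]
  have e : ∀ a b c d : ZMod 2, ptIdx ![a, b, c, d] =
    a.val + 2 * b.val + 4 * c.val + 8 * d.val := fun _ _ _ _ => rfl
  simp only [e, ZMod.val_zero, ZMod.val_one]
  norm_num only [popc_eq, Nat.pow_zero, Nat.div_one]
  ac_rfl

lemma exists_tab (f : (Fin 4 → ZMod 2) → ZMod 2) : ∃ n < 65536, f = tabF n := by
  refine ⟨Nat.ofBits (fun i : Fin 16 => decide (f ![(i.val : ZMod 2), (i.val / 2 : ℕ),
    (i.val / 4 : ℕ), (i.val / 8 : ℕ)] = 1)), ?_, ?_⟩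
  · exact Nat.ofBits_lt_two_pow _
  · funext v
    unfold tabF
    rw [Nat.testBit_ofBits_lt _ _ (ptIdx_lt v)]
    simp only [← ptIdx_inv v]
    rcases zmod2_cases (f v) with h | h <;> simp [h]

lemma normalize_aff (f : (Fin 4 → ZMod 2) → ZMod 2) : ∃ p, (f + affMap p) ![0, 0, 0, 0] = 0 ∧
    (f + affMap p) ![1, 0, 0, 0] = 0 ∧ (f + affMap p) ![0, 1, 0, 0] = 0 ∧
    (f + affMap p) ![0, 0, 1, 0] = 0 ∧ (f + affMap p) ![0, 0, 0, 1] = 0 := by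
  have h2 : ∀ x y : ZMod 2, x + (x + y + y) = 0 := by decide
  have h3 : ∀ x : ZMod 2, x + x = 0 := by decide
  refine ⟨(![f ![1,0,0,0] + f ![0,0,0,0], f ![0,1,0,0] + f ![0,0,0,0],
    f ![0,0,1,0] + f ![0,0,0,0], f ![0,0,0,1] + f ![0,0,0,0]], f ![0,0,0,0]), ?_, ?_, ?_, ?_, ?_⟩ <;>
  simp [affMap_apply, Fin.sum_univ_four, h2, h3]

lemma norm_form (n : ℕ) (hn : n < 65536) (h0 : tabF n ![0, 0, 0, 0] = 0)
    (h1 : tabF n ![1, 0, 0, 0] = 0) (h2 : tabF n ![0, 1, 0, 0] = 0)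
    (h3 : tabF n ![0, 0, 1, 0] = 0) (h4 : tabF n ![0, 0, 0, 1] = 0) :
    ∃ x < 2, ∃ y < 8, ∃ z < 128, n = 8 * x + 32 * y + 512 * z := by
  have e0 : ptIdx ![0, 0, 0, 0] = 0 := by decide
  have e1 : ptIdx ![1, 0, 0, 0] = 1 := by decide
  have e2 : ptIdx ![0, 1, 0, 0] = 2 := by decide
  have e3 : ptIdx ![0, 0, 1, 0] = 4 := by decide
  have e4 : ptIdx ![0, 0, 0, 1] = 8 := by decide
  simp only [tabF, e0, e1, e2, e3, e4, Nat.testBit_eq_decide_div_mod_eq] at h0 h1 h2 h3 h4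
  simp at h0 h1 h2 h3 h4
  refine ⟨n / 8 % 2, by omega, n / 32 % 8, by omega, n / 512, by omega, by omega⟩

lemma classify (f : (Fin 4 → ZMod 2) → ZMod 2) (a : ℕ) (ha : 0 < a) (ha' : a < 8)
    (h : ∀ p, wt (f + affMap p) = 8 - a ∨ wt (f + affMap p) = 8 ∨ wt (f + affMap p) = 8 + a)
    (h0 : f ![0, 0, 0, 0] = 0)
    (h1 : f ![1, 0, 0, 0] = 0) (h2 : f ![0, 1, 0, 0] = 0)
    (h3 : f ![0, 0, 1, 0] = 0) (h4 : f ![0, 0, 0, 1] = 0) :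
    CodeEquiv (codeOf f : Set ((Fin 4 → ZMod 2) → ZMod 2)) (codeOf (tabF 30856)) ∨
    CodeEquiv (codeOf f : Set ((Fin 4 → ZMod 2) → ZMod 2)) (codeOf (tabF 34952)) := by
  obtain ⟨n, hn, rfl⟩ := exists_tab f
  obtain ⟨x, hx, y, hy, z, hz, hnxyz⟩ := norm_form n hn h0 h1 h2 h3 h4
  have hg : goodTab n a = true := by
    unfold goodTab
    rw [List.all_eq_true]
    intro t ht
    obtain ⟨p, hp⟩ := affTab_mem t ht
    have := h p
    rw [hp, ← tabF_xor, wt_tabF] at this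
    have e : Nat.xor n t = n ^^^ t := rfl
    rw [e]
    clear h
    generalize popc (n ^^^ t) = q at this
    interval_cases a <;> rcases this with rfl | rfl | rfl <;> rfl
  have hs := searchOK_true
  unfold searchOK at hs
  simp only [List.all_eq_true, List.mem_range] at hs
  have hs1 := hs x hx y hy z hz a (by simp; omega)
  rw [← hnxyz, hg] at hs1
  simp only [Bool.not_true, Bool.false_or, List.any_eq_true, Nat.beq_eq] at hs1
  obtain ⟨r, hr, rfl⟩ := hs1
  obtain ⟨ha1, ha2, ha3, ha4⟩ := quadTab_aff r hr
  have hsp := fun v => quadTab_spec r hr (ptIdx v) (ptIdx_lt v)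
  have hE := codeEquiv_of (tabF r.1) (tabF r.2.2.2.2)
    ⟨linMap r.2.1, linMap r.2.2.1,
      fun v => ptIdx_inj (by rw [ptIdx_linMap, ptIdx_linMap]; exact (hsp v).1),
      fun v => ptIdx_inj (by rw [ptIdx_linMap, ptIdx_linMap]; exact (hsp v).2.1)⟩
    (linMap_aff _ ha1) (linMap_aff _ ha2) _ (affTab_mem _ ha3) (by
      rw [← tabF_xor]
      ext v
      simp only [Function.comp_apply, Equiv.coe_fn_mk, tabF, ptIdx_linMap, (hsp v).2.2])
  rcases ha4 with h | h
  · left; rwa [h] at hE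
  · right; rwa [h] at hE

lemma main_class (C : Submodule (ZMod 2) ((Fin 4 → ZMod 2) → ZMod 2)) (a : ℕ)
    (hC : SatCond 4 6 a C) :
    CodeEquiv (C : Set ((Fin 4 → ZMod 2) → ZMod 2)) (codeOf (tabF 30856)) ∨
    CodeEquiv (C : Set ((Fin 4 → ZMod 2) → ZMod 2)) (codeOf (tabF 34952)) := by
  obtain ⟨hd, ha, ha', hw, hR⟩ := hC
  have hR' : LinearMap.range affMap ≤ C := fun x hx => hR ((mem_RM1_iff x).2 hx)
  have hex : ∃ f ∈ C, f ∉ LinearMap.range affMap := by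
    by_contra! hcon
    have : C ≤ LinearMap.range affMap := hcon
    have := Submodule.finrank_mono this
    rw [hd, finrank_affRange] at this
    omega
  obtain ⟨f₀, hf₀C, hf₀⟩ := hex
  obtain ⟨p, h0, h1, h2, h3, h4⟩ := normalize_aff f₀
  have hp : affMap p ∈ LinearMap.range affMap := ⟨p, rfl⟩
  have hfC : f₀ + affMap p ∈ C := C.add_mem hf₀C (hR' hp)
  have hf : f₀ + affMap p ∉ LinearMap.range affMap := fun h =>
    hf₀ ((Submodule.add_mem_iff_left _ hp).1 h)
  generalize f₀ + affMap p = f at *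
  rw [eq_codeOf C hd hR' f hfC hf]
  refine classify f a ha ha' ?_ h0 h1 h2 h3 h4
  intro q
  have hq : affMap q ∈ LinearMap.range affMap := ⟨q, rfl⟩
  have hmem : wt (f + affMap q) ∈ {w : ℕ | ∃ x ∈ C, wt x = w} :=
    ⟨_, C.add_mem hfC (hR' hq), rfl⟩
  have hn : f + affMap q ∉ LinearMap.range affMap := fun h =>
    hf ((Submodule.add_mem_iff_left _ hq).1 h)
  have hz : wt (f + affMap q) ≠ 0 := by
    intro h
    apply hn
    unfold wt at h
    rw [Finset.card_eq_zero, Finset.filter_eq_empty_iff] at h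
    have : f + affMap q = 0 := by
      ext v
      simpa using h (Finset.mem_univ v)
    rw [this]; exact Submodule.zero_mem _
  have hs : wt (f + affMap q) ≠ 16 := by
    intro h
    apply hn
    unfold wt at h
    have hc : (Finset.univ : Finset (Fin 4 → ZMod 2)).card = 16 := by simp
    rw [← hc, Finset.card_filter_eq_iff] at h
    refine ⟨(0, 1), ?_⟩
    ext v
    rcases zmod2_cases ((f + affMap q) v) with h' | h'
    · exact absurd h' (h v (Finset.mem_univ v))
    · rw [h']; simp [affMap_apply]
  rw [hw] at hmem
  simp only [Set.mem_insert_iff, Set.mem_singleton_iff] at hmem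
  norm_num at hmem
  tauto

lemma mem_codeOf_tab (n : ℕ) (x : (Fin 4 → ZMod 2) → ZMod 2) :
    x ∈ codeOf (tabF n) ↔ ∃ t ∈ affTab, x = tabF t ∨ x = tabF (n ^^^ t) := by
  rw [mem_codeOf]
  constructor
  · rintro ⟨p, h⟩
    obtain ⟨t, ht, e⟩ := affMap_tab p
    refine ⟨t, ht, ?_⟩
    rw [tabF_xor, ← e, add_comm]
    exact h
  · rintro ⟨t, ht, h⟩
    obtain ⟨p, e⟩ := affTab_mem t ht
    refine ⟨p, ?_⟩
    rw [tabF_xor, ← e, add_comm] at h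
    exact h

lemma weights_codeOf (n : ℕ) : {w : ℕ | ∃ x ∈ codeOf (tabF n), wt x = w} =
    {w | w ∈ affTab.map popc ++ affTab.map fun t => popc (n ^^^ t)} := by
  ext w
  simp only [Set.mem_ofPred_eq, mem_codeOf_tab, List.mem_append, List.mem_map]
  constructor
  · rintro ⟨x, ⟨t, ht, rfl | rfl⟩, rfl⟩
    · exact Or.inl ⟨t, ht, (wt_tabF _).symm⟩
    · exact Or.inr ⟨t, ht, (wt_tabF _).symm⟩
  · rintro (⟨t, ht, rfl⟩ | ⟨t, ht, rfl⟩)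
    · exact ⟨_, ⟨t, ht, Or.inl rfl⟩, wt_tabF _⟩
    · exact ⟨_, ⟨t, ht, Or.inr rfl⟩, wt_tabF _⟩

lemma weights_eq (n a : ℕ)
    (h1 : ∀ w ∈ affTab.map popc ++ affTab.map fun t => popc (n ^^^ t), w ∈ [0, 8 - a, 8, 8 + a, 16])
    (h2 : ∀ w ∈ [0, 8 - a, 8, 8 + a, 16], w ∈ affTab.map popc ++ affTab.map fun t => popc (n ^^^ t)) :
    {w : ℕ | ∃ x ∈ codeOf (tabF n), wt x = w} = ({0, 8 - a, 8, 8 + a, 16} : Set ℕ) := by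
  rw [weights_codeOf]
  ext w
  have : w ∈ ({0, 8 - a, 8, 8 + a, 16} : Set ℕ) ↔ w ∈ [0, 8 - a, 8, 8 + a, 16] := by simp
  rw [this]
  exact ⟨h1 w, h2 w⟩

lemma weights1 : {w : ℕ | ∃ x ∈ codeOf (tabF 30856), wt x = w} = ({0, 6, 8, 10, 16} : Set ℕ) :=
  weights_eq 30856 2 (by decide +kernel) (by decide +kernel)

lemma weights2 : {w : ℕ | ∃ x ∈ codeOf (tabF 34952), wt x = w} = ({0, 4, 8, 12, 16} : Set ℕ) :=
  weights_eq 34952 4 (by decide +kernel) (by decide +kernel)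

lemma not_aff (n : ℕ) (h : ∀ t ∈ affTab, popc (n ^^^ t) ≠ 0) :
    tabF n ∉ LinearMap.range affMap := by
  rintro ⟨p, hp⟩
  obtain ⟨t, ht, e⟩ := affMap_tab p
  apply h t ht
  rw [← wt_tabF, tabF_xor, ← hp, e]
  have h3 : ∀ x : ZMod 2, x + x = 0 := by decide
  simp [wt, h3]

lemma dmin_of (C : Submodule (ZMod 2) ((Fin 4 → ZMod 2) → ZMod 2)) (a : ℕ) (ha : 0 < a)
    (ha' : a < 8)
    (h : {w : ℕ | ∃ x ∈ C, wt x = w} = ({0, 8 - a, 8, 8 + a, 16} : Set ℕ)) :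
    dmin (C : Set ((Fin 4 → ZMod 2) → ZMod 2)) = 8 - a := by
  unfold dmin
  apply IsLeast.csInf_eq
  constructor
  · have : 8 - a ∈ {w : ℕ | ∃ x ∈ C, wt x = w} := by rw [h]; simp
    obtain ⟨x, hx, hxw⟩ := this
    refine ⟨x, hx, ?_, hxw⟩
    rintro rfl
    simp [wt] at hxw
    omega
  · rintro w ⟨x, hx, hx0, hxw⟩
    have hm : w ∈ {w : ℕ | ∃ x ∈ C, wt x = w} := ⟨x, hx, hxw⟩
    rw [h] at hm
    have hw0 : w ≠ 0 := by
      rintro rfl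
      apply hx0
      unfold wt at hxw
      rw [Finset.card_eq_zero, Finset.filter_eq_empty_iff] at hxw
      ext v
      simpa using hxw (Finset.mem_univ v)
    simp only [Set.mem_insert_iff, Set.mem_singleton_iff] at hm
    omega

lemma wt_comp (x : (Fin 4 → ZMod 2) → ZMod 2) (σ : Equiv.Perm (Fin 4 → ZMod 2)) :
    wt (x ∘ σ) = wt x := by
  unfold wt
  rw [Finset.card_filter, Finset.card_filter]
  exact Equiv.sum_comp σ (fun v => if x v ≠ 0 then 1 else 0)

/-- up to equivalence there exist exactly two binary `[16,6]`
codes satisfying (C1) and (C2), one of minimum weight 6 and one of minimum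
weight 4. -/
theorem stmt11 :
    ∃ (C₁ C₂ : Submodule (ZMod 2) ((Fin 4 → ZMod 2) → ZMod 2)) (a₁ a₂ : ℕ),
      SatCond 4 6 a₁ C₁ ∧ SatCond 4 6 a₂ C₂ ∧
      dmin (↑C₁ : Set ((Fin 4 → ZMod 2) → ZMod 2)) = 6 ∧
      dmin (↑C₂ : Set ((Fin 4 → ZMod 2) → ZMod 2)) = 4 ∧
      ¬ CodeEquiv (↑C₁ : Set ((Fin 4 → ZMod 2) → ZMod 2)) (↑C₂) ∧
      ∀ (C : Submodule (ZMod 2) ((Fin 4 → ZMod 2) → ZMod 2)) (a : ℕ),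
        SatCond 4 6 a C →
        CodeEquiv (↑C : Set ((Fin 4 → ZMod 2) → ZMod 2)) (↑C₁) ∨
        CodeEquiv (↑C : Set ((Fin 4 → ZMod 2) → ZMod 2)) (↑C₂) := by
  refine ⟨codeOf (tabF 30856), codeOf (tabF 34952), 2, 4, ?_, ?_, ?_, ?_, ?_, main_class⟩
  · refine ⟨finrank_codeOf _ (not_aff _ (by decide +kernel)), by norm_num, by norm_num,
      weights1, fun x hx => ?_⟩
    exact (le_sup_left : _ ≤ codeOf (tabF 30856)) ((mem_RM1_iff x).1 hx)
  · refine ⟨finrank_codeOf _ (not_aff _ (by decide +kernel)), by norm_num, by norm_num,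
      weights2, fun x hx => ?_⟩
    exact (le_sup_left : _ ≤ codeOf (tabF 34952)) ((mem_RM1_iff x).1 hx)
  · exact dmin_of _ 2 (by norm_num) (by norm_num) weights1
  · exact dmin_of _ 4 (by norm_num) (by norm_num) weights2
  · rintro ⟨σ, hσ⟩
    have h4 : 4 ∈ {w : ℕ | ∃ x ∈ codeOf (tabF 34952), wt x = w} := by
      rw [weights2]; simp
    obtain ⟨x, hx, hxw⟩ := h4
    rw [← SetLike.mem_coe, hσ] at hx
    obtain ⟨y, hy, rfl⟩ := hx
    have h4' : 4 ∈ {w : ℕ | ∃ x ∈ codeOf (tabF 30856), wt x = w} :=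
      ⟨y, hy, (wt_comp y σ).symm.trans hxw⟩
    rw [weights1] at h4'
    simp at h4'
end
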